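/- arXiv:1012.0688 — 2 statements merged into one kernel-verified Lean document; each statement's English description precedes it below -/
import Mathlib

section
/- Assume Ω ⊂ ℝ^N is a bounded domain with a C¹ boundary, H is continuous and coercive ((A1)), u₀ ∈ W^{1,∞}(Ω), and γ, g are continuous with γ(x)·n(x) > 0 on ∂Ω. Let u ∈ C(cl(Ω)×[0,∞)) be a subsolution of the Cauchy–Neumann problem (CN) and v a lower semicontinuous supersolution of (CN). If u(·,0) ≤ v(·,0) on cl(Ω), then u ≤ v on cl(Ω)×[0,∞). -/
open Set Metric Filter
open scoped RealInnerProductSpace Topology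

noncomputable section

abbrev Euc (N : ℕ) : Type := EuclideanSpace ℝ (Fin N)

/-- (A1): coercivity of the Hamiltonian, uniformly over `closure Ω`. -/
def Coercive {N : ℕ} (Ω : Set (Euc N)) (H : Euc N → Euc N → ℝ) : Prop :=
  ∀ M : ℝ, ∃ r : ℝ, ∀ x ∈ closure Ω, ∀ p : Euc N, r ≤ ‖p‖ → M ≤ H x p

/-- `Ω` has a `C⁰` boundary: near each boundary point, in a suitable orthonormal frame,
`Ω` is the region strictly above the graph of a continuous function. -/
def HasC0Boundary {N : ℕ} (Ω : Set (Euc N)) : Prop :=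
  ∀ z ∈ frontier Ω, ∃ (ν : Euc N) (r : ℝ) (b : Euc N → ℝ),
    ‖ν‖ = 1 ∧ 0 < r ∧ Continuous b ∧
    Ω ∩ ball z r = {x ∈ ball z r | b (x - ⟪x, ν⟫ • ν) < ⟪x, ν⟫}

/-- `Ω` has a `C¹` boundary. -/
def HasC1Boundary {N : ℕ} (Ω : Set (Euc N)) : Prop :=
  ∀ z ∈ frontier Ω, ∃ (ν : Euc N) (r : ℝ) (b : Euc N → ℝ),
    ‖ν‖ = 1 ∧ 0 < r ∧ ContDiff ℝ 1 b ∧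
    Ω ∩ ball z r = {x ∈ ball z r | b (x - ⟪x, ν⟫ • ν) < ⟪x, ν⟫}

/-- `nz` is the outer unit normal vector to `Ω` at the boundary point `z`. -/
def IsOuterUnitNormalAt {N : ℕ} (Ω : Set (Euc N)) (z nz : Euc N) : Prop :=
  ‖nz‖ = 1 ∧ ∀ ε : ℝ, 0 < ε → ∃ δ : ℝ, 0 < δ ∧
    ∀ x ∈ closure Ω, ‖x - z‖ < δ → ⟪x - z, nz⟫ ≤ ε * ‖x - z‖

/-- time derivative `φ_t` of a test function on `ℝ^N × ℝ`. -/
def timeDeriv {N : ℕ} (φ : Euc N × ℝ → ℝ) (p : Euc N × ℝ) : ℝ :=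
  fderiv ℝ φ p (0, 1)

/-- spatial gradient `D_x φ` of a test function on `ℝ^N × ℝ`. -/
def spaceGrad {N : ℕ} (φ : Euc N × ℝ → ℝ) (p : Euc N × ℝ) : Euc N :=
  gradient (fun y => φ (y, p.2)) p.1

/-- viscosity subsolution of `u_t + H(x,Du) = 0`, tested at points of `S × (0,∞)`,
local maxima being relative to `S × (0,∞)`. -/
def ParSubOn {N : ℕ} (H : Euc N → Euc N → ℝ) (u : Euc N × ℝ → ℝ) (S : Set (Euc N)) : Prop :=
  ∀ φ : Euc N × ℝ → ℝ, ContDiff ℝ 1 φ → ∀ x ∈ S, ∀ t : ℝ, 0 < t →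
    IsLocalMaxOn (fun p => u p - φ p) (S ×ˢ Ioi (0:ℝ)) (x, t) →
    timeDeriv φ (x, t) + H x (spaceGrad φ (x, t)) ≤ 0

/-- viscosity supersolution of `u_t + H(x,Du) = 0`, tested at points of `S × (0,∞)`. -/
def ParSuperOn {N : ℕ} (H : Euc N → Euc N → ℝ) (u : Euc N × ℝ → ℝ) (S : Set (Euc N)) : Prop :=
  ∀ φ : Euc N × ℝ → ℝ, ContDiff ℝ 1 φ → ∀ x ∈ S, ∀ t : ℝ, 0 < t →
    IsLocalMinOn (fun p => u p - φ p) (S ×ˢ Ioi (0:ℝ)) (x, t) →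
    0 ≤ timeDeriv φ (x, t) + H x (spaceGrad φ (x, t))

/-- Neumann/oblique boundary condition, viscosity sense, subsolution part. -/
def NeumannSubBC {N : ℕ} (Ω : Set (Euc N)) (H : Euc N → Euc N → ℝ)
    (γ : Euc N → Euc N) (g : Euc N → ℝ) (u : Euc N × ℝ → ℝ) : Prop :=
  ∀ φ : Euc N × ℝ → ℝ, ContDiff ℝ 1 φ → ∀ x ∈ frontier Ω, ∀ t : ℝ, 0 < t →
    IsLocalMaxOn (fun p => u p - φ p) (closure Ω ×ˢ Ioi (0:ℝ)) (x, t) →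
    min (timeDeriv φ (x, t) + H x (spaceGrad φ (x, t)))
      (⟪γ x, spaceGrad φ (x, t)⟫ - g x) ≤ 0

/-- Neumann/oblique boundary condition, viscosity sense, supersolution part. -/
def NeumannSuperBC {N : ℕ} (Ω : Set (Euc N)) (H : Euc N → Euc N → ℝ)
    (γ : Euc N → Euc N) (g : Euc N → ℝ) (u : Euc N × ℝ → ℝ) : Prop :=
  ∀ φ : Euc N × ℝ → ℝ, ContDiff ℝ 1 φ → ∀ x ∈ frontier Ω, ∀ t : ℝ, 0 < t →
    IsLocalMinOn (fun p => u p - φ p) (closure Ω ×ˢ Ioi (0:ℝ)) (x, t) →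
    0 ≤ max (timeDeriv φ (x, t) + H x (spaceGrad φ (x, t)))
      (⟪γ x, spaceGrad φ (x, t)⟫ - g x)

/-- Dirichlet boundary condition, viscosity sense, subsolution part. -/
def DirichletSubBC {N : ℕ} (Ω : Set (Euc N)) (H : Euc N → Euc N → ℝ)
    (g : Euc N → ℝ) (u : Euc N × ℝ → ℝ) : Prop :=
  ∀ φ : Euc N × ℝ → ℝ, ContDiff ℝ 1 φ → ∀ x ∈ frontier Ω, ∀ t : ℝ, 0 < t →
    IsLocalMaxOn (fun p => u p - φ p) (closure Ω ×ˢ Ioi (0:ℝ)) (x, t) →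
    min (timeDeriv φ (x, t) + H x (spaceGrad φ (x, t))) (u (x, t) - g x) ≤ 0

/-- Dirichlet boundary condition, viscosity sense, supersolution part. -/
def DirichletSuperBC {N : ℕ} (Ω : Set (Euc N)) (H : Euc N → Euc N → ℝ)
    (g : Euc N → ℝ) (u : Euc N × ℝ → ℝ) : Prop :=
  ∀ φ : Euc N × ℝ → ℝ, ContDiff ℝ 1 φ → ∀ x ∈ frontier Ω, ∀ t : ℝ, 0 < t →
    IsLocalMinOn (fun p => u p - φ p) (closure Ω ×ˢ Ioi (0:ℝ)) (x, t) →
    0 ≤ max (timeDeriv φ (x, t) + H x (spaceGrad φ (x, t))) (u (x, t) - g x)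

/-- subsolution of the Cauchy–Neumann problem (CN) (equation and boundary condition). -/
def IsCNSub {N : ℕ} (Ω : Set (Euc N)) (H : Euc N → Euc N → ℝ)
    (γ : Euc N → Euc N) (g : Euc N → ℝ) (u : Euc N × ℝ → ℝ) : Prop :=
  UpperSemicontinuousOn u (closure Ω ×ˢ Ici (0:ℝ)) ∧
  ParSubOn H u Ω ∧ NeumannSubBC Ω H γ g u

/-- supersolution of the Cauchy–Neumann problem (CN). -/
def IsCNSuper {N : ℕ} (Ω : Set (Euc N)) (H : Euc N → Euc N → ℝ)
    (γ : Euc N → Euc N) (g : Euc N → ℝ) (u : Euc N × ℝ → ℝ) : Prop :=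
  LowerSemicontinuousOn u (closure Ω ×ˢ Ici (0:ℝ)) ∧
  ParSuperOn H u Ω ∧ NeumannSuperBC Ω H γ g u

/-- solution of (CN) with initial datum `u₀`. -/
def IsCNSolution {N : ℕ} (Ω : Set (Euc N)) (H : Euc N → Euc N → ℝ)
    (γ : Euc N → Euc N) (g : Euc N → ℝ) (u₀ : Euc N → ℝ) (u : Euc N × ℝ → ℝ) : Prop :=
  IsCNSub Ω H γ g u ∧ IsCNSuper Ω H γ g u ∧ ∀ x ∈ closure Ω, u (x, 0) = u₀ x

/-- subsolution for the state-constraint problem (SC). -/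
def IsSCSub {N : ℕ} (Ω : Set (Euc N)) (H : Euc N → Euc N → ℝ) (u : Euc N × ℝ → ℝ) : Prop :=
  UpperSemicontinuousOn u (closure Ω ×ˢ Ici (0:ℝ)) ∧ ParSubOn H u Ω

/-- supersolution for the state-constraint problem (SC): supersolution on `closure Ω`. -/
def IsSCSuper {N : ℕ} (Ω : Set (Euc N)) (H : Euc N → Euc N → ℝ) (u : Euc N × ℝ → ℝ) : Prop :=
  LowerSemicontinuousOn u (closure Ω ×ˢ Ici (0:ℝ)) ∧ ParSuperOn H u (closure Ω)

/-- solution of (SC) with initial datum `u₀`. -/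
def IsSCSolution {N : ℕ} (Ω : Set (Euc N)) (H : Euc N → Euc N → ℝ)
    (u₀ : Euc N → ℝ) (u : Euc N × ℝ → ℝ) : Prop :=
  IsSCSub Ω H u ∧ IsSCSuper Ω H u ∧ ∀ x ∈ closure Ω, u (x, 0) = u₀ x

/-- subsolution of the Cauchy–Dirichlet problem (CD). -/
def IsCDSub {N : ℕ} (Ω : Set (Euc N)) (H : Euc N → Euc N → ℝ)
    (g : Euc N → ℝ) (u : Euc N × ℝ → ℝ) : Prop :=
  UpperSemicontinuousOn u (closure Ω ×ˢ Ici (0:ℝ)) ∧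
  ParSubOn H u Ω ∧ DirichletSubBC Ω H g u

/-- supersolution of the Cauchy–Dirichlet problem (CD). -/
def IsCDSuper {N : ℕ} (Ω : Set (Euc N)) (H : Euc N → Euc N → ℝ)
    (g : Euc N → ℝ) (u : Euc N × ℝ → ℝ) : Prop :=
  LowerSemicontinuousOn u (closure Ω ×ˢ Ici (0:ℝ)) ∧
  ParSuperOn H u Ω ∧ DirichletSuperBC Ω H g u

/-- solution of (CD) with initial datum `u₀`. -/
def IsCDSolution {N : ℕ} (Ω : Set (Euc N)) (H : Euc N → Euc N → ℝ)
    (g : Euc N → ℝ) (u₀ : Euc N → ℝ) (u : Euc N × ℝ → ℝ) : Prop :=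
  IsCDSub Ω H g u ∧ IsCDSuper Ω H g u ∧ ∀ x ∈ closure Ω, u (x, 0) = u₀ x

/-- viscosity subsolution of `H(x,Dv) = a`, tested at points of `S`,
local maxima relative to `S`. -/
def StatSubOn {N : ℕ} (H : Euc N → Euc N → ℝ) (a : ℝ) (v : Euc N → ℝ) (S : Set (Euc N)) : Prop :=
  ∀ φ : Euc N → ℝ, ContDiff ℝ 1 φ → ∀ x ∈ S,
    IsLocalMaxOn (fun y => v y - φ y) S x → H x (gradient φ x) ≤ a

/-- viscosity supersolution of `H(x,Dv) = a`, tested at points of `S`. -/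
def StatSuperOn {N : ℕ} (H : Euc N → Euc N → ℝ) (a : ℝ) (v : Euc N → ℝ) (S : Set (Euc N)) : Prop :=
  ∀ φ : Euc N → ℝ, ContDiff ℝ 1 φ → ∀ x ∈ S,
    IsLocalMinOn (fun y => v y - φ y) S x → a ≤ H x (gradient φ x)

/-- stationary Neumann boundary condition, subsolution part. -/
def NeumannStatSubBC {N : ℕ} (Ω : Set (Euc N)) (H : Euc N → Euc N → ℝ)
    (γ : Euc N → Euc N) (g : Euc N → ℝ) (a : ℝ) (v : Euc N → ℝ) : Prop :=
  ∀ φ : Euc N → ℝ, ContDiff ℝ 1 φ → ∀ x ∈ frontier Ω,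
    IsLocalMaxOn (fun y => v y - φ y) (closure Ω) x →
    min (H x (gradient φ x) - a) (⟪γ x, gradient φ x⟫ - g x) ≤ 0

/-- stationary Neumann boundary condition, supersolution part. -/
def NeumannStatSuperBC {N : ℕ} (Ω : Set (Euc N)) (H : Euc N → Euc N → ℝ)
    (γ : Euc N → Euc N) (g : Euc N → ℝ) (a : ℝ) (v : Euc N → ℝ) : Prop :=
  ∀ φ : Euc N → ℝ, ContDiff ℝ 1 φ → ∀ x ∈ frontier Ω,
    IsLocalMinOn (fun y => v y - φ y) (closure Ω) x →
    0 ≤ max (H x (gradient φ x) - a) (⟪γ x, gradient φ x⟫ - g x)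

/-- subsolution of the ergodic Neumann problem (E-N) with constant `a`. -/
def IsENSub {N : ℕ} (Ω : Set (Euc N)) (H : Euc N → Euc N → ℝ)
    (γ : Euc N → Euc N) (g : Euc N → ℝ) (a : ℝ) (v : Euc N → ℝ) : Prop :=
  UpperSemicontinuousOn v (closure Ω) ∧ StatSubOn H a v Ω ∧ NeumannStatSubBC Ω H γ g a v

/-- supersolution of the ergodic Neumann problem (E-N) with constant `a`. -/
def IsENSuper {N : ℕ} (Ω : Set (Euc N)) (H : Euc N → Euc N → ℝ)
    (γ : Euc N → Euc N) (g : Euc N → ℝ) (a : ℝ) (v : Euc N → ℝ) : Prop :=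
  LowerSemicontinuousOn v (closure Ω) ∧ StatSuperOn H a v Ω ∧ NeumannStatSuperBC Ω H γ g a v

/-- solution of (E-N) with constant `a`. -/
def IsENSolution {N : ℕ} (Ω : Set (Euc N)) (H : Euc N → Euc N → ℝ)
    (γ : Euc N → Euc N) (g : Euc N → ℝ) (a : ℝ) (v : Euc N → ℝ) : Prop :=
  IsENSub Ω H γ g a v ∧ IsENSuper Ω H γ g a v

/-- solution of the ergodic state-constraint problem (E-SC) with constant `a`:
continuous on `closure Ω`, subsolution in `Ω`, supersolution on `closure Ω`. -/
def IsESCSolution {N : ℕ} (Ω : Set (Euc N)) (H : Euc N → Euc N → ℝ)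
    (a : ℝ) (v : Euc N → ℝ) : Prop :=
  ContinuousOn v (closure Ω) ∧ StatSubOn H a v Ω ∧ StatSuperOn H a v (closure Ω)

/-- stationary Dirichlet boundary condition, subsolution part. -/
def DirichletStatSubBC {N : ℕ} (Ω : Set (Euc N)) (H : Euc N → Euc N → ℝ)
    (g : Euc N → ℝ) (a : ℝ) (v : Euc N → ℝ) : Prop :=
  ∀ φ : Euc N → ℝ, ContDiff ℝ 1 φ → ∀ x ∈ frontier Ω,
    IsLocalMaxOn (fun y => v y - φ y) (closure Ω) x →
    min (H x (gradient φ x) - a) (v x - g x) ≤ 0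

/-- stationary Dirichlet boundary condition, supersolution part. -/
def DirichletStatSuperBC {N : ℕ} (Ω : Set (Euc N)) (H : Euc N → Euc N → ℝ)
    (g : Euc N → ℝ) (a : ℝ) (v : Euc N → ℝ) : Prop :=
  ∀ φ : Euc N → ℝ, ContDiff ℝ 1 φ → ∀ x ∈ frontier Ω,
    IsLocalMinOn (fun y => v y - φ y) (closure Ω) x →
    0 ≤ max (H x (gradient φ x) - a) (v x - g x)

/-- subsolution of the stationary Dirichlet problem (D)_a. -/
def IsDaSub {N : ℕ} (Ω : Set (Euc N)) (H : Euc N → Euc N → ℝ)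
    (g : Euc N → ℝ) (a : ℝ) (v : Euc N → ℝ) : Prop :=
  UpperSemicontinuousOn v (closure Ω) ∧ StatSubOn H a v Ω ∧ DirichletStatSubBC Ω H g a v

/-- supersolution of the stationary Dirichlet problem (D)_a. -/
def IsDaSuper {N : ℕ} (Ω : Set (Euc N)) (H : Euc N → Euc N → ℝ)
    (g : Euc N → ℝ) (a : ℝ) (v : Euc N → ℝ) : Prop :=
  LowerSemicontinuousOn v (closure Ω) ∧ StatSuperOn H a v Ω ∧ DirichletStatSuperBC Ω H g a v

/-- solution of (D)_a. -/
def IsDaSolution {N : ℕ} (Ω : Set (Euc N)) (H : Euc N → Euc N → ℝ)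
    (g : Euc N → ℝ) (a : ℝ) (v : Euc N → ℝ) : Prop :=
  IsDaSub Ω H g a v ∧ IsDaSuper Ω H g a v

/-- the state-constraint ergodic constant
`c_sc = inf{a | H(x,Dv) = a has a subsolution v ∈ C(cl Ω)}`. -/
def cSC {N : ℕ} (Ω : Set (Euc N)) (H : Euc N → Euc N → ℝ) : ℝ :=
  sInf {a : ℝ | ∃ v : Euc N → ℝ, ContinuousOn v (closure Ω) ∧ StatSubOn H a v Ω}

/-- (A2)_a^+ with a fixed `η` and constant `ψ = ψ_η`. -/
def A2plusAt {N : ℕ} (Ω : Set (Euc N)) (H : Euc N → Euc N → ℝ) (a η ψ : ℝ) : Prop :=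
  ∀ x ∈ closure Ω, ∀ p q : Euc N, η ≤ H x (p + q) - a → H x q - a ≤ 0 →
    ∀ μ : ℝ, 0 < μ → μ ≤ 1 →
      (H x (p + q) - a) + ψ * (1 - μ) ≤ μ * (H x (μ⁻¹ • p + q) - a)

/-- (A2)_a^+ with a given threshold `η₀`. -/
def A2plusWith {N : ℕ} (Ω : Set (Euc N)) (H : Euc N → Euc N → ℝ) (a η₀ : ℝ) : Prop :=
  ∀ η : ℝ, 0 < η → η ≤ η₀ → ∃ ψ : ℝ, 0 < ψ ∧ A2plusAt Ω H a η ψ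

/-- assumption (A2)_a^+. -/
def A2plus {N : ℕ} (Ω : Set (Euc N)) (H : Euc N → Euc N → ℝ) (a : ℝ) : Prop :=
  ∃ η₀ : ℝ, 0 < η₀ ∧ A2plusWith Ω H a η₀

/-- (A2)_a^- with a fixed `η` and constant `ψ = ψ_η`. -/
def A2minusAt {N : ℕ} (Ω : Set (Euc N)) (H : Euc N → Euc N → ℝ) (a η ψ : ℝ) : Prop :=
  ∀ x ∈ closure Ω, ∀ p q : Euc N, H x (p + q) - a ≤ -η → 0 ≤ H x q - a →
    ∀ μ : ℝ, 1 ≤ μ →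
      μ * (H x (μ⁻¹ • p + q) - a) ≤ (H x (p + q) - a) - ψ * (μ - 1) / μ

/-- (A2)_a^- with a given threshold `η₀`. -/
def A2minusWith {N : ℕ} (Ω : Set (Euc N)) (H : Euc N → Euc N → ℝ) (a η₀ : ℝ) : Prop :=
  ∀ η : ℝ, 0 < η → η ≤ η₀ → ∃ ψ : ℝ, 0 < ψ ∧ A2minusAt Ω H a η ψ

/-- assumption (A2)_a^-. -/
def A2minus {N : ℕ} (Ω : Set (Euc N)) (H : Euc N → Euc N → ℝ) (a : ℝ) : Prop :=
  ∃ η₀ : ℝ, 0 < η₀ ∧ A2minusWith Ω H a η₀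

/-- `u(x,t) - (v(x) - c t) → 0` uniformly on `closure Ω` as `t → ∞`. -/
def UnifConvTo {N : ℕ} (Ω : Set (Euc N)) (u : Euc N × ℝ → ℝ) (v : Euc N → ℝ) (c : ℝ) : Prop :=
  ∀ ε : ℝ, 0 < ε → ∃ T : ℝ, ∀ t : ℝ, T ≤ t → ∀ x ∈ closure Ω,
    |u (x, t) - (v x - c * t)| < ε

/-- conclusion of the asymptotically increasing property for `u_c = u + ct`. -/
def AsympIncConcl {N : ℕ} (Ω : Set (Euc N)) (u : Euc N × ℝ → ℝ) (c η : ℝ) : Prop :=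
  ∃ δ : ℝ → ℝ, (∀ s : ℝ, 0 ≤ s → δ s ∈ Icc (0:ℝ) 1) ∧ Tendsto δ atTop (𝓝 0) ∧
    ∀ x ∈ closure Ω, ∀ s t : ℝ, 0 ≤ s → s ≤ t →
      (u (x, s) + c * s) - (u (x, t) + c * t) + η * (s - t) ≤ δ s

/-- conclusion of the asymptotically decreasing property for `u_c = u + ct`. -/
def AsympDecConcl {N : ℕ} (Ω : Set (Euc N)) (u : Euc N × ℝ → ℝ) (c η : ℝ) : Prop :=
  ∃ δ : ℝ → ℝ, (∀ s : ℝ, 0 ≤ s → 0 ≤ δ s) ∧ Tendsto δ atTop (𝓝 0) ∧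
    ∀ x ∈ closure Ω, ∀ s t : ℝ, 0 ≤ s → s ≤ t →
      (u (x, t) + c * t) - (u (x, s) + c * s) - η * (t - s) ≤ δ s

/-- the function `μ_η^+` associated with `u_c` and `v_c`. -/
def muPlus {N : ℕ} (Ω : Set (Euc N)) (uc : Euc N × ℝ → ℝ) (vc : Euc N → ℝ) (η s : ℝ) : ℝ :=
  sInf {r : ℝ | ∃ x ∈ closure Ω, ∃ t : ℝ, s ≤ t ∧
    r = (uc (x, t) - vc x + η * (t - s)) / (uc (x, s) - vc x)}

/-- the function `μ_η^-` associated with `u_c` and `v_c`. -/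
def muMinus {N : ℕ} (Ω : Set (Euc N)) (uc : Euc N × ℝ → ℝ) (vc : Euc N → ℝ) (η s : ℝ) : ℝ :=
  sSup {r : ℝ | ∃ x ∈ closure Ω, ∃ t : ℝ, s ≤ t ∧
    r = (uc (x, t) - vc x - η * (t - s)) / (uc (x, s) - vc x)}

/-- normalization `1 ≤ u_c - v_c ≤ C` on `closure Ω × [0,∞)`. -/
def NormalizedGap {N : ℕ} (Ω : Set (Euc N)) (u : Euc N × ℝ → ℝ) (vc : Euc N → ℝ) (c C : ℝ) : Prop :=
  ∀ x ∈ closure Ω, ∀ t : ℝ, 0 ≤ t →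
    1 ≤ (u (x, t) + c * t) - vc x ∧ (u (x, t) + c * t) - vc x ≤ C

/-! ### Semicontinuity on compact sets -/

/-- If an upper semicontinuous function is `< c` on the zero set of `d` in a compact set, then it is
`< c` on a sublevel set of `d`. -/
lemma exists_pos_forall_lt_of_upperSemicontinuousOn {X : Type*} [TopologicalSpace X] {S : Set X}
    (hS : IsCompact S) {f d : X → ℝ} (hf : UpperSemicontinuousOn f S) (hd : ContinuousOn d S)
    {c : ℝ} (h : ∀ z ∈ S, d z ≤ 0 → f z < c) :
    ∃ m > 0, ∀ z ∈ S, d z < m → f z < c := by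
  refine hS.induction_on (p := fun s => ∃ m > 0, ∀ z ∈ s, d z < m → f z < c)
    ⟨1, one_pos, by simp⟩ ?_ ?_ ?_
  · rintro s t hst ⟨m, hm, h⟩
    exact ⟨m, hm, fun z hz => h z (hst hz)⟩
  · rintro s t ⟨m, hm, h⟩ ⟨m', hm', h'⟩
    refine ⟨min m m', lt_min hm hm', ?_⟩
    rintro z (hz | hz) hlt
    · exact h z hz (hlt.trans_le (min_le_left _ _))
    · exact h' z hz (hlt.trans_le (min_le_right _ _))
  · intro z hz
    rcases le_or_gt (d z) 0 with h0 | h0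
    · exact ⟨_, hf z hz c (h z hz h0), 1, one_pos, fun y hy _ => hy⟩
    · refine ⟨_, (hd z hz).eventually (lt_mem_nhds (half_lt_self h0)), d z / 2, half_pos h0, ?_⟩
      intro y hy hlt
      exact absurd hlt (not_lt.2 (le_of_lt hy))

lemma upperSemicontinuousOn_sub_comp {X Y : Type*} [TopologicalSpace X] [TopologicalSpace Y]
    {S : Set X} {T : Set Y} {F : X → ℝ} {v : Y → ℝ} {pr : X → Y}
    (hv : LowerSemicontinuousOn v T) (hpr : ContinuousOn pr S) (hmaps : MapsTo pr S T)
    (hF : ContinuousOn F S) : UpperSemicontinuousOn (fun z => F z - v (pr z)) S := by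
  have h1 : LowerSemicontinuousOn (v ∘ pr) S := hv.comp hpr hmaps
  have h2 : UpperSemicontinuousOn (fun z => F z + (-(v ∘ pr)) z) S :=
    hF.upperSemicontinuousOn.add h1.neg
  simpa [sub_eq_add_neg] using h2

/-! ### Testing with separated test functions -/

lemma contDiff_separated {N : ℕ} {f : Euc N → ℝ} {h : ℝ → ℝ} (hf : ContDiff ℝ 1 f)
    (hh : ContDiff ℝ 1 h) : ContDiff ℝ 1 (fun p : Euc N × ℝ => f p.1 + h p.2) :=
  (hf.comp contDiff_fst).add (hh.comp contDiff_snd)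

lemma timeDeriv_separated {N : ℕ} {f : Euc N → ℝ} {h : ℝ → ℝ} {x G : Euc N} {t a : ℝ}
    (hf : HasGradientAt f G x) (hh : HasDerivAt h a t) :
    timeDeriv (fun p : Euc N × ℝ => f p.1 + h p.2) (x, t) = a := by
  have h1 := (hasGradientAt_iff_hasFDerivAt.1 hf).comp (x, t)
    (hasFDerivAt_fst (𝕜 := ℝ) (E := Euc N) (F := ℝ) (p := (x, t)))
  have h2 := hh.hasFDerivAt.comp (x, t)
    (hasFDerivAt_snd (𝕜 := ℝ) (E := Euc N) (F := ℝ) (p := (x, t)))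
  have h3 := (h1.add h2).fderiv
  unfold timeDeriv
  have h4 : (fun p : Euc N × ℝ => f p.1 + h p.2) = (f ∘ Prod.fst + h ∘ Prod.snd) := rfl
  rw [h4, h3]
  simp

lemma spaceGrad_separated {N : ℕ} {f : Euc N → ℝ} {h : ℝ → ℝ} {x G : Euc N} {t : ℝ}
    (hf : HasGradientAt f G x) :
    spaceGrad (fun p : Euc N × ℝ => f p.1 + h p.2) (x, t) = G := by
  unfold spaceGrad
  have h1 : HasGradientAt (fun y => f y + h t) G x := by
    rw [hasGradientAt_iff_hasFDerivAt] at hf ⊢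
    exact hf.add_const _
  exact h1.gradient

lemma ParSubOn.test {N : ℕ} {Ω : Set (Euc N)} {H : Euc N → Euc N → ℝ} {u : Euc N × ℝ → ℝ}
    (hu : ParSubOn H u Ω) {f : Euc N → ℝ} {h : ℝ → ℝ} (hf : ContDiff ℝ 1 f) (hh : ContDiff ℝ 1 h)
    {x G : Euc N} {t a : ℝ} (hx : x ∈ Ω) (ht : 0 < t) (hfG : HasGradientAt f G x)
    (hha : HasDerivAt h a t)
    (hmax : IsLocalMaxOn (fun p => u p - (f p.1 + h p.2)) (Ω ×ˢ Ioi (0 : ℝ)) (x, t)) :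
    a + H x G ≤ 0 := by
  have := hu _ (contDiff_separated hf hh) x hx t ht hmax
  rwa [timeDeriv_separated hfG hha, spaceGrad_separated hfG] at this

lemma mem_or_mem_frontier_of_mem_closure {X : Type*} [TopologicalSpace X] {Ω : Set X}
    (hΩ : IsOpen Ω) {x : X} (hx : x ∈ closure Ω) : x ∈ Ω ∨ x ∈ frontier Ω := by
  by_cases h : x ∈ Ω
  · exact Or.inl h
  · exact Or.inr ⟨hx, by rwa [hΩ.interior_eq]⟩

lemma IsCNSub.test {N : ℕ} {Ω : Set (Euc N)} {H : Euc N → Euc N → ℝ} {γ : Euc N → Euc N}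
    {g : Euc N → ℝ} {u : Euc N × ℝ → ℝ} (hΩ : IsOpen Ω) (hu : IsCNSub Ω H γ g u)
    {f : Euc N → ℝ} {h : ℝ → ℝ} (hf : ContDiff ℝ 1 f) (hh : ContDiff ℝ 1 h)
    {x G : Euc N} {t a : ℝ} (hx : x ∈ closure Ω) (ht : 0 < t) (hfG : HasGradientAt f G x)
    (hha : HasDerivAt h a t)
    (hmax : IsLocalMaxOn (fun p => u p - (f p.1 + h p.2)) (closure Ω ×ˢ Ioi (0 : ℝ)) (x, t))
    (hbd : x ∈ frontier Ω → 0 < ⟪γ x, G⟫ - g x) : a + H x G ≤ 0 := by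
  rcases mem_or_mem_frontier_of_mem_closure hΩ hx with h1 | h1
  · exact hu.2.1.test hf hh h1 ht hfG hha
      (hmax.on_subset (prod_mono subset_closure Subset.rfl))
  · have := hu.2.2 _ (contDiff_separated hf hh) x h1 t ht hmax
    rw [timeDeriv_separated hfG hha, spaceGrad_separated hfG] at this
    rcases min_le_iff.1 this with h2 | h2
    · exact h2
    · exact absurd h2 (not_le.2 (hbd h1))

lemma IsCNSuper.test {N : ℕ} {Ω : Set (Euc N)} {H : Euc N → Euc N → ℝ} {γ : Euc N → Euc N}
    {g : Euc N → ℝ} {v : Euc N × ℝ → ℝ} (hΩ : IsOpen Ω) (hv : IsCNSuper Ω H γ g v)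
    {f : Euc N → ℝ} {h : ℝ → ℝ} (hf : ContDiff ℝ 1 f) (hh : ContDiff ℝ 1 h)
    {x G : Euc N} {t a : ℝ} (hx : x ∈ closure Ω) (ht : 0 < t) (hfG : HasGradientAt f G x)
    (hha : HasDerivAt h a t)
    (hmin : IsLocalMinOn (fun p => v p - (f p.1 + h p.2)) (closure Ω ×ˢ Ioi (0 : ℝ)) (x, t))
    (hbd : x ∈ frontier Ω → ⟪γ x, G⟫ - g x < 0) : 0 ≤ a + H x G := by
  rcases mem_or_mem_frontier_of_mem_closure hΩ hx with h1 | h1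
  · have := hv.2.1 _ (contDiff_separated hf hh) x h1 t ht
      (hmin.on_subset (prod_mono subset_closure Subset.rfl))
    rwa [timeDeriv_separated hfG hha, spaceGrad_separated hfG] at this
  · have := hv.2.2 _ (contDiff_separated hf hh) x h1 t ht hmin
    rw [timeDeriv_separated hfG hha, spaceGrad_separated hfG] at this
    rcases le_max_iff.1 this with h2 | h2
    · exact h2
    · exact absurd h2 (not_le.2 (hbd h1))

/-! ### Lipschitz estimates from one-sided slope bounds -/

/-- A continuous function whose upper slopes are bounded by `R` at every point of a segment is
`R`-Lipschitz along that segment. -/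
lemma sub_le_of_slope_le_on_segment {E : Type*} [NormedAddCommGroup E] [NormedSpace ℝ E]
    {w : E → ℝ} {R : ℝ} {x y : E} (hw : ContinuousOn w (segment ℝ x y))
    (hloc : ∀ z ∈ segment ℝ x y, ∀ r > R, ∀ᶠ z' in 𝓝 z, w z' ≤ w z + r * ‖z' - z‖) :
    w y - w x ≤ R * ‖y - x‖ := by
  rcases eq_or_ne x y with rfl | hne
  · simp
  have hpos : 0 < ‖y - x‖ := norm_pos_iff.2 (sub_ne_zero.2 hne.symm)
  set c : ℝ → E := fun l => x + l • (y - x) with hc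
  have hcc : Continuous c := by fun_prop
  have hmem : ∀ l ∈ Icc (0:ℝ) 1, c l ∈ segment ℝ x y := by
    intro l hl
    rw [segment_eq_image']
    exact ⟨l, hl, rfl⟩
  have key := image_le_of_liminf_slope_right_le_deriv_boundary (f := fun l => w (c l))
    (a := 0) (b := 1) (hw.comp hcc.continuousOn hmem)
    (B := fun l => w x + (R * ‖y - x‖) * l) (B' := fun _ => R * ‖y - x‖) (by simp [hc])
    (by fun_prop)
    (fun l _ => by
      simpa using (((hasDerivAt_id l).const_mul (R * ‖y - x‖)).const_add (w x)).hasDerivWithinAt)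
    (by
      intro l hl r hr
      apply Eventually.frequently
      obtain ⟨r', hr1, hr2⟩ := exists_between hr
      have h1 : R < r' / ‖y - x‖ := (lt_div_iff₀ hpos).2 hr1
      have h2 := hcc.continuousAt.eventually
        (hloc (c l) (hmem l ⟨hl.1, hl.2.le⟩) _ h1)
      filter_upwards [nhdsWithin_le_nhds h2, self_mem_nhdsWithin] with z hz hzl
      have hzl' : 0 < z - l := sub_pos.2 hzl
      have h3 : ‖c z - c l‖ = (z - l) * ‖y - x‖ := by
        have : c z - c l = (z - l) • (y - x) := by simp only [hc]; module
        rw [this, norm_smul, Real.norm_of_nonneg hzl'.le]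
      rw [slope_def_field]
      refine lt_of_le_of_lt ?_ hr2
      rw [div_le_iff₀ hzl']
      rw [h3] at hz
      have : r' / ‖y - x‖ * ((z - l) * ‖y - x‖) = r' * (z - l) := by
        field_simp
      linarith)
  have := key (right_mem_Icc.2 zero_le_one)
  simp only [hc, one_smul, add_sub_cancel, mul_one] at this
  linarith

/-! ### The sup-convolution in time -/

/-- Sup-convolution of `u` in the time variable over `[0, T]`, evaluated at time `s`. -/
def timeSup {N : ℕ} (u : Euc N × ℝ → ℝ) (T ε s : ℝ) (x : Euc N) : ℝ :=
  sSup ((fun t => u (x, t) - (t - s) ^ 2 / ε) '' Icc 0 T)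

section TimeSup

variable {N : ℕ} {K : Set (Euc N)} {u : Euc N × ℝ → ℝ} {T ε s : ℝ}

lemma continuousOn_time_slice (hu : ContinuousOn u (K ×ˢ Ici (0 : ℝ))) {x : Euc N} (hx : x ∈ K) :
    ContinuousOn (fun t => u (x, t) - (t - s) ^ 2 / ε) (Icc 0 T) := by
  refine ContinuousOn.sub (hu.comp (by fun_prop) ?_) (by fun_prop)
  intro t ht
  exact ⟨hx, ht.1⟩

lemma le_timeSup (hu : ContinuousOn u (K ×ˢ Ici (0 : ℝ))) {x : Euc N} (hx : x ∈ K) {t : ℝ}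
    (ht : t ∈ Icc 0 T) : u (x, t) - (t - s) ^ 2 / ε ≤ timeSup u T ε s x :=
  le_csSup (isCompact_Icc.image_of_continuousOn (continuousOn_time_slice hu hx)).bddAbove
    ⟨t, ht, rfl⟩

lemma exists_timeSup_eq (hu : ContinuousOn u (K ×ˢ Ici (0 : ℝ))) (hT : 0 ≤ T) {x : Euc N}
    (hx : x ∈ K) : ∃ t ∈ Icc 0 T, timeSup u T ε s x = u (x, t) - (t - s) ^ 2 / ε :=
  isCompact_Icc.exists_sSup_image_eq (nonempty_Icc.2 hT) (continuousOn_time_slice hu hx)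

lemma continuousOn_timeSup (hK : IsCompact K) (hu : ContinuousOn u (K ×ˢ Ici (0 : ℝ)))
    (hT : 0 ≤ T) : ContinuousOn (timeSup u T ε s) K := by
  have hc : IsCompact (K ×ˢ Icc 0 T) := hK.prod isCompact_Icc
  have huc := hc.uniformContinuousOn_of_continuous
    (hu.mono (prod_mono Subset.rfl Icc_subset_Ici_self))
  rw [Metric.uniformContinuousOn_iff] at huc
  have key : ∀ e > 0, ∃ d > 0, ∀ x ∈ K, ∀ y ∈ K, dist x y < d →
      timeSup u T ε s x ≤ timeSup u T ε s y + e := by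
    intro e he
    obtain ⟨d, hd, h⟩ := huc e he
    refine ⟨d, hd, fun x hx y hy hxy => ?_⟩
    obtain ⟨t, ht, hte⟩ := exists_timeSup_eq (ε := ε) (s := s) hu hT hx
    have h1 := h (x, t) ⟨hx, ht⟩ (y, t) ⟨hy, ht⟩ (by simpa [Prod.dist_eq, hd] using hxy)
    have h2 := le_timeSup (ε := ε) (s := s) hu hy ht
    rw [Real.dist_eq] at h1
    have := (abs_lt.1 h1).2
    linarith
  rw [Metric.continuousOn_iff]
  intro x hx e he
  obtain ⟨d, hd, h⟩ := key (e / 2) (half_pos he)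
  refine ⟨d, hd, fun y hy hyx => ?_⟩
  have h1 := h y hy x hx hyx
  have h2 := h x hx y hy (by rwa [dist_comm])
  rw [Real.dist_eq, abs_lt]
  constructor <;> linarith

end TimeSup

lemma hasGradientAt_norm_sub_sq {N : ℕ} (z y : Euc N) :
    HasGradientAt (fun y : Euc N => ‖y - z‖ ^ 2) ((2 : ℝ) • (y - z)) y := by
  rw [hasGradientAt_iff_hasFDerivAt]
  have := ((hasFDerivAt_id (𝕜 := ℝ) y).sub_const z).norm_sq
  refine this.congr_fderiv ?_
  ext w
  simp

lemma hasGradientAt_cone {N : ℕ} (z y : Euc N) {κ : ℝ} (hκ : 0 < κ) (a b : ℝ) :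
    HasGradientAt (fun y : Euc N => a * √(κ ^ 2 + ‖y - z‖ ^ 2) + b * ‖y - z‖ ^ 2)
      ((a / √(κ ^ 2 + ‖y - z‖ ^ 2) + 2 * b) • (y - z)) y := by
  have h0 := hasGradientAt_iff_hasFDerivAt.1 (hasGradientAt_norm_sub_sq z y)
  have hne : κ ^ 2 + ‖y - z‖ ^ 2 ≠ 0 := by positivity
  have h1 := (((h0.const_add (κ ^ 2)).sqrt hne).const_mul a).add (h0.const_mul b)
  rw [hasGradientAt_iff_hasFDerivAt]
  refine h1.congr_fderiv ?_
  ext w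
  simp
  field_simp

lemma contDiff_cone {N : ℕ} (z : Euc N) {κ : ℝ} (hκ : 0 < κ) (a b : ℝ) :
    ContDiff ℝ 1 (fun y : Euc N => a * √(κ ^ 2 + ‖y - z‖ ^ 2) + b * ‖y - z‖ ^ 2) := by
  have h0 : ContDiff ℝ 1 (fun y : Euc N => ‖y - z‖ ^ 2) := (contDiff_id.sub contDiff_const).norm_sq ℝ
  have hne : ∀ y : Euc N, κ ^ 2 + ‖y - z‖ ^ 2 ≠ 0 := fun y => by positivity
  exact (contDiff_const.mul ((contDiff_const.add h0).sqrt hne)).add (contDiff_const.mul h0)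

/-- Coercivity bounds the upper slopes of the sup-convolution in time of a subsolution. -/
lemma ParSubOn.timeSup_slope {N : ℕ} {Ω : Set (Euc N)} {H : Euc N → Euc N → ℝ}
    {u : Euc N × ℝ → ℝ} (hΩ : IsOpen Ω) (hK : IsCompact (closure Ω))
    (hu : ContinuousOn u (closure Ω ×ˢ Ici (0 : ℝ))) (hsub : ParSubOn H u Ω)
    {T ε s R : ℝ} (hT : 0 ≤ T) (hε : 0 < ε) (hsT : s ≤ T) (hR : 0 < R)
    (hHR : ∀ x ∈ Ω, ∀ p : Euc N, R ≤ ‖p‖ → 2 * T / ε < H x p)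
    (hint : ∀ x ∈ Ω, ∀ t ∈ Icc 0 T, timeSup u T ε s x = u (x, t) - (t - s) ^ 2 / ε →
      0 < t ∧ t < T)
    {z : Euc N} (hz : z ∈ Ω) {r : ℝ} (hr : 2 * R < r) :
    ∀ᶠ z' in 𝓝 z, timeSup u T ε s z' ≤ timeSup u T ε s z + r * ‖z' - z‖ := by
  set w := timeSup u T ε s with hw
  have hwc : ContinuousOn w (closure Ω) := continuousOn_timeSup hK hu hT
  obtain ⟨ρ, hρ, hball⟩ := Metric.nhds_basis_closedBall.mem_iff.1 (hΩ.mem_nhds hz)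
  have hballc : closedBall z ρ ⊆ closure Ω := hball.trans subset_closure
  obtain ⟨B, hB⟩ := (isCompact_closedBall z ρ).exists_bound_of_continuousOn (hwc.mono hballc)
  have hzρ : z ∈ closedBall z ρ := mem_closedBall_self hρ.le
  have hB0 : 0 ≤ B := (norm_nonneg _).trans (hB z hzρ)
  set Q : ℝ := (2 * B + 1) / ρ ^ 2 with hQ
  have hQ0 : 0 < Q := by positivity
  have hQρ : Q * ρ ^ 2 = 2 * B + 1 := by rw [hQ]; field_simp
  have quad : ∀ x ∈ closedBall z ρ, w x ≤ w z + 2 * R * ‖x - z‖ + Q * ‖x - z‖ ^ 2 := by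
    intro x hx
    refine le_of_forall_pos_le_add fun e he => ?_
    have hcz : ContinuousAt w z := hwc.continuousAt (mem_of_superset (hΩ.mem_nhds hz) subset_closure)
    obtain ⟨κ, hκ, hκw⟩ := Metric.continuousAt_iff.1 hcz e he
    set f : Euc N → ℝ := fun y => 2 * R * √(κ ^ 2 + ‖y - z‖ ^ 2) + Q * ‖y - z‖ ^ 2 with hf
    have hfC : ContDiff ℝ 1 f := contDiff_cone z hκ (2 * R) Q
    obtain ⟨y, hy, hymax⟩ := (isCompact_closedBall z ρ).exists_isMaxOn ⟨z, hzρ⟩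
      ((hwc.mono hballc).sub hfC.continuous.continuousOn)
    replace hymax : ∀ y' ∈ closedBall z ρ, w y' - f y' ≤ w y - f y := fun _ h => hymax h
    have hyz : w z - f z ≤ w y - f y := hymax z hzρ
    have hyx : w x - f x ≤ w y - f y := hymax x hx
    simp only [hf, sub_self, norm_zero, ne_eq, OfNat.ofNat_ne_zero,
      not_false_eq_true, zero_pow, add_zero, mul_zero, Real.sqrt_sq hκ.le] at hyz hyx
    set d := ‖y - z‖ with hd
    have hd0 : 0 ≤ d := norm_nonneg _
    have hsqrt : κ ≤ √(κ ^ 2 + d ^ 2) := by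
      refine Real.le_sqrt_of_sq_le ?_
      nlinarith
    have hsqrt0 : 0 < √(κ ^ 2 + d ^ 2) := hκ.trans_le hsqrt
    have hdρ : d < ρ := by
      refine lt_of_le_of_ne (by simpa [hd, dist_eq_norm] using hy) fun hdr => ?_
      have h1 := abs_le.1 (hB y hy)
      have h2 := abs_le.1 (hB z hzρ)
      rw [hdr] at hyz hsqrt
      nlinarith
    have hyΩ : y ∈ Ω := hball hy
    have hyK : y ∈ closure Ω := hballc hy
    obtain ⟨t, ht, hte⟩ := exists_timeSup_eq (ε := ε) (s := s) hu hT hyK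
    obtain ⟨ht0, htT⟩ := hint y hyΩ t ht hte
    have hdt : HasDerivAt (fun t : ℝ => (t - s) ^ 2 / ε) (2 * (t - s) / ε) t := by
      have := (((hasDerivAt_id t).sub_const s).pow 2).div_const ε
      simpa using this
    have htest := hsub.test (h := fun t => (t - s) ^ 2 / ε) hfC (by fun_prop) hyΩ ht0
      (hasGradientAt_cone z y hκ (2 * R) Q) hdt (by
        have hnb : ∀ᶠ p : Euc N × ℝ in 𝓝 (y, t), p.1 ∈ ball z ρ ∧ p.2 ∈ Ioo 0 T := by
          refine (continuous_fst.continuousAt.eventually (isOpen_ball.mem_nhds ?_)).and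
            (continuous_snd.continuousAt.eventually (isOpen_Ioo.mem_nhds ⟨ht0, htT⟩))
          simpa [dist_eq_norm, hd] using hdρ
        refine Filter.Eventually.filter_mono nhdsWithin_le_nhds ?_
        filter_upwards [hnb] with p hp
        have h1 : p.1 ∈ closedBall z ρ := ball_subset_closedBall hp.1
        have h2 := hymax p.1 h1
        have h3 := le_timeSup (ε := ε) (s := s) hu (hballc h1) (Ioo_subset_Icc_self hp.2)
        rw [← hw] at h3 hte
        have h4 : u p = u (p.1, p.2) := rfl
        linarith)
    have hHle : H y ((2 * R / √(κ ^ 2 + ‖y - z‖ ^ 2) + 2 * Q) • (y - z)) ≤ 2 * T / ε := by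
      have : -(2 * (t - s) / ε) ≤ 2 * T / ε := by
        rw [← neg_div]
        apply div_le_div_of_nonneg_right _ hε.le
        linarith
      linarith
    have hG : ‖(2 * R / √(κ ^ 2 + ‖y - z‖ ^ 2) + 2 * Q) • (y - z)‖ < R := by
      by_contra! hcon
      exact absurd hHle (not_le.2 (hHR y hyΩ _ hcon))
    rw [norm_smul, ← hd, Real.norm_of_nonneg (by positivity)] at hG
    have hdκ : d < κ := by
      have h1 : 2 * R / √(κ ^ 2 + d ^ 2) * d < R := by nlinarith [mul_nonneg hQ0.le hd0]
      have h2 : 2 * d < √(κ ^ 2 + d ^ 2) := by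
        rw [div_mul_eq_mul_div, div_lt_iff₀ hsqrt0] at h1
        nlinarith
      have h3 := Real.sq_sqrt (show 0 ≤ κ ^ 2 + d ^ 2 by positivity)
      nlinarith
    have hwy := hκw (show dist y z < κ by rwa [dist_eq_norm])
    rw [Real.dist_eq] at hwy
    have hwy := (abs_lt.1 hwy).2
    have hx1 : √(κ ^ 2 + ‖x - z‖ ^ 2) ≤ κ + ‖x - z‖ := by
      refine Real.sqrt_le_iff.2 ⟨by positivity, ?_⟩
      nlinarith [mul_nonneg hκ.le (norm_nonneg (x - z))]
    have h1 := mul_le_mul_of_nonneg_left hx1 hR.le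
    have h2 := mul_le_mul_of_nonneg_left hsqrt hR.le
    have h3 := mul_nonneg hQ0.le (sq_nonneg d)
    linarith
  have hpos : 0 < (r - 2 * R) / Q := div_pos (by linarith) hQ0
  filter_upwards [Metric.closedBall_mem_nhds z hρ, Metric.closedBall_mem_nhds z hpos] with x hx hx'
  have h1 := quad x hx
  rw [mem_closedBall, dist_eq_norm, le_div_iff₀ hQ0] at hx'
  nlinarith [norm_nonneg (x - z)]

/-! ### Local geometry of `C¹` domains -/

/-- Near a boundary point, a `C¹` domain is a strict sublevel set of a `C¹` function that decreases
at unit speed along a fixed direction. -/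
lemma HasC1Boundary.exists_defining {N : ℕ} {Ω : Set (Euc N)} (h : HasC1Boundary Ω) {z : Euc N}
    (hz : z ∈ frontier Ω) : ∃ (ν : Euc N) (r : ℝ) (G : Euc N → ℝ), ‖ν‖ = 1 ∧ 0 < r ∧
      ContDiff ℝ 1 G ∧ (∀ x a, G (x + a • ν) = G x - a) ∧
      ∀ x ∈ ball z r, x ∈ Ω ↔ G x < 0 := by
  obtain ⟨ν, r, b, hν, hr, hb, hΩ⟩ := h z hz
  refine ⟨ν, r, fun x => b (x - ⟪x, ν⟫ • ν) - ⟪x, ν⟫, hν, hr, ?_, ?_, ?_⟩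
  · have h1 : ContDiff ℝ 1 (fun x : Euc N => ⟪x, ν⟫) := contDiff_id.inner ℝ contDiff_const
    exact (hb.comp (contDiff_id.sub (h1.smul contDiff_const))).sub h1
  · intro x a
    have h1 : ⟪x + a • ν, ν⟫ = ⟪x, ν⟫ + a := by
      rw [inner_add_left, real_inner_smul_left, real_inner_self_eq_norm_sq, hν]; ring
    have h2 : x + a • ν - (⟪x, ν⟫ + a) • ν = x - ⟪x, ν⟫ • ν := by module
    simp only [h1, h2]
    ring
  · intro x hx
    have h1 : x ∈ Ω ↔ x ∈ Ω ∩ ball z r := by simp [hx]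
    rw [h1, hΩ]
    exact ⟨fun h => sub_neg.2 h.2, fun h => ⟨hx, sub_neg.1 h⟩⟩

section Defining

variable {N : ℕ} {Ω : Set (Euc N)} {z : Euc N} {r : ℝ} {G : Euc N → ℝ}

lemma nonpos_of_mem_closure_of_defining (hG : Continuous G)
    (hΩ : ∀ x ∈ ball z r, x ∈ Ω ↔ G x < 0) {x : Euc N} (hx : x ∈ closure Ω) (hxr : x ∈ ball z r) :
    G x ≤ 0 := by
  have h1 : x ∈ closure (ball z r ∩ Ω) := isOpen_ball.inter_closure ⟨hxr, hx⟩
  have h2 : closure (ball z r ∩ Ω) ⊆ {x | G x ≤ 0} :=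
    closure_minimal (fun y hy => ((hΩ y hy.1).1 hy.2).le) (isClosed_le hG continuous_const)
  exact h2 h1

lemma eq_zero_of_mem_frontier_of_defining (hΩo : IsOpen Ω) (hG : Continuous G)
    (hΩ : ∀ x ∈ ball z r, x ∈ Ω ↔ G x < 0) {x : Euc N} (hx : x ∈ frontier Ω)
    (hxr : x ∈ ball z r) : G x = 0 := by
  refine le_antisymm (nonpos_of_mem_closure_of_defining hG hΩ (frontier_subset_closure hx) hxr) ?_
  rw [hΩo.frontier_eq] at hx
  exact not_lt.1 fun h => hx.2 ((hΩ x hxr).2 h)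

end Defining

/-- Pointwise slope bounds inside a `C¹` domain give a Lipschitz bound up to the boundary. -/
lemma HasC1Boundary.exists_lipschitz_of_slope {N : ℕ} {Ω : Set (Euc N)} (hC1 : HasC1Boundary Ω)
    (hΩ : IsOpen Ω) {x₀ : Euc N} (hx₀ : x₀ ∈ closure Ω) :
    ∃ r > 0, ∃ C ≥ 0, ∀ (w : Euc N → ℝ) (R : ℝ), 0 ≤ R → ContinuousOn w (closure Ω) →
      (∀ z ∈ Ω, ∀ r > R, ∀ᶠ z' in 𝓝 z, w z' ≤ w z + r * ‖z' - z‖) →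
      ∀ x ∈ closure Ω, x ∈ ball x₀ r → ∀ y ∈ closure Ω, y ∈ ball x₀ r →
        w x - w y ≤ C * R * ‖x - y‖ := by
  have hseg : ∀ (w : Euc N → ℝ) (R : ℝ), ContinuousOn w (closure Ω) →
      (∀ z ∈ Ω, ∀ r > R, ∀ᶠ z' in 𝓝 z, w z' ≤ w z + r * ‖z' - z‖) →
      ∀ x y, segment ℝ x y ⊆ Ω → w y - w x ≤ R * ‖y - x‖ := fun w R hw hloc x y hxy =>
    sub_le_of_slope_le_on_segment (hw.mono (hxy.trans subset_closure))
      fun z hz => hloc z (hxy hz)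
  rcases mem_or_mem_frontier_of_mem_closure hΩ hx₀ with h0 | h0
  · obtain ⟨r, hr, hball⟩ := Metric.isOpen_iff.1 hΩ x₀ h0
    refine ⟨r, hr, 1, zero_le_one, fun w R _ hw hloc x _ hx y _ hy => ?_⟩
    rw [one_mul]
    exact hseg w R hw hloc y x (((convex_ball x₀ r).segment_subset hy hx).trans hball)
  obtain ⟨ν, r₀, G, hν, hr₀, hG, hGν, hΩG⟩ := hC1.exists_defining h0
  obtain ⟨K, s, hs, hlip⟩ :=
    (hG.contDiffAt.hasStrictFDerivAt (x := x₀) one_ne_zero).exists_lipschitzOnWith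
  obtain ⟨r₁, hr₁, hr₁s⟩ := Metric.mem_nhds_iff.1 (inter_mem hs (ball_mem_nhds x₀ hr₀))
  have hK : (0 : ℝ) ≤ K := K.2
  set r : ℝ := r₁ / (1 + 2 * K) with hrdef
  have hr : 0 < r := by positivity
  have hrr : r + 2 * K * r = r₁ := by rw [hrdef]; field_simp
  have hrle : r ≤ r₁ := by nlinarith
  refine ⟨r, hr, 2 * K + 1, by positivity, fun w R hR hw hloc => ?_⟩
  have main : ∀ x ∈ ball x₀ r ∩ Ω, ∀ y ∈ ball x₀ r ∩ Ω,
      w x - w y ≤ (2 * K + 1) * R * ‖x - y‖ := by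
    rintro x ⟨hx, hxΩ⟩ y ⟨hy, hyΩ⟩
    have hxy : ‖x - y‖ < 2 * r := by
      rw [mem_ball, dist_eq_norm] at hx hy
      have h1 : x - y = (x - x₀) - (y - x₀) := by abel
      have h2 := norm_sub_le (x - x₀) (y - x₀)
      rw [h1]; linarith
    set a : ℝ := K * ‖x - y‖ with ha
    have ha0 : 0 ≤ a := by positivity
    have hshift : ∀ p ∈ ball x₀ r, ∀ b, 0 ≤ b → b ≤ a → p + b • ν ∈ ball x₀ r₁ := by
      intro p hp b hb hba
      rw [mem_ball, dist_eq_norm] at hp ⊢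
      have h1 : p + b • ν - x₀ = (p - x₀) + b • ν := by abel
      have h2 := norm_add_le (p - x₀) (b • ν)
      rw [norm_smul, hν, Real.norm_of_nonneg hb, mul_one] at h2
      rw [h1]; nlinarith
    have hvert : ∀ p ∈ ball x₀ r, p ∈ Ω → segment ℝ p (p + a • ν) ⊆ Ω := by
      intro p hp hpΩ q hq
      rw [segment_eq_image'] at hq
      obtain ⟨l, hl, rfl⟩ := hq
      have h1 : p + l • (p + a • ν - p) = p + (l * a) • ν := by module
      have hla : 0 ≤ l * a := mul_nonneg hl.1 ha0
      simp only [h1]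
      have h2 := hshift p hp (l * a) hla (by nlinarith [hl.2])
      rw [hΩG _ (hr₁s h2).2, hGν]
      have := (hΩG p (hr₁s (ball_subset_ball hrle hp)).2).1 hpΩ
      linarith
    have hhor : segment ℝ (y + a • ν) (x + a • ν) ⊆ Ω := by
      intro q hq
      rw [segment_eq_image'] at hq
      obtain ⟨l, hl, rfl⟩ := hq
      have h1 : y + a • ν + l • (x + a • ν - (y + a • ν)) = (y + l • (x - y)) + a • ν := by module
      simp only [h1]
      have hp : y + l • (x - y) ∈ ball x₀ r := by
        refine (convex_ball x₀ r).segment_subset hy hx ?_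
        rw [segment_eq_image']
        exact ⟨l, hl, rfl⟩
      have h2 := hshift _ hp a ha0 le_rfl
      rw [hΩG _ (hr₁s h2).2, hGν]
      have h3 := (hΩG y (hr₁s (ball_subset_ball hrle hy)).2).1 hyΩ
      have h4 := hlip.dist_le_mul _ (hr₁s (ball_subset_ball hrle hp)).1 y
        (hr₁s (ball_subset_ball hrle hy)).1
      rw [Real.dist_eq, dist_eq_norm, add_sub_cancel_left, norm_smul,
        Real.norm_of_nonneg hl.1] at h4
      have h5 := (abs_le.1 h4).2
      have h6 : (K : ℝ) * (l * ‖x - y‖) ≤ a := by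
        rw [ha]
        have : l * ‖x - y‖ ≤ ‖x - y‖ := by nlinarith [hl.2, norm_nonneg (x - y)]
        exact mul_le_mul_of_nonneg_left this hK
      linarith
    have e1 := hseg w R hw hloc _ _ (hvert y hy hyΩ)
    have e2 := hseg w R hw hloc _ _ hhor
    have e3 := hseg w R hw hloc _ _ ((segment_symm ℝ _ _).trans_subset (hvert x hx hxΩ))
    have n1 : ‖y + a • ν - y‖ = a := by
      rw [add_sub_cancel_left, norm_smul, hν, Real.norm_of_nonneg ha0, mul_one]
    have n2 : ‖x + a • ν - (y + a • ν)‖ = ‖x - y‖ := by congr 1; abel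
    have n3 : ‖x - (x + a • ν)‖ = a := by
      rw [sub_add_cancel_left, norm_neg, norm_smul, hν, Real.norm_of_nonneg ha0, mul_one]
    rw [n1] at e1
    rw [n2] at e2
    rw [n3] at e3
    have : (2 * K + 1) * R * ‖x - y‖ = R * a + R * ‖x - y‖ + R * a := by rw [ha]; ring
    linarith
  have hcl : ∀ x ∈ closure Ω, x ∈ ball x₀ r → x ∈ closure (ball x₀ r ∩ Ω) := fun x hx hxr =>
    isOpen_ball.inter_closure ⟨hxr, hx⟩
  intro x hx hxr y hy hyr
  have step : ∀ p ∈ ball x₀ r ∩ Ω, w p - w y ≤ (2 * K + 1) * R * ‖p - y‖ := fun p hp =>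
    ContinuousWithinAt.closure_le (hcl y hy hyr)
      (continuousWithinAt_const.sub ((hw y hy).mono (inter_subset_right.trans subset_closure)))
      (by fun_prop) (fun q hq => main p hp q hq)
  exact ContinuousWithinAt.closure_le (hcl x hx hxr)
    (((hw x hx).mono (inter_subset_right.trans subset_closure)).sub continuousWithinAt_const)
    (by fun_prop) step

/-! ### Quadratic penalisation and barrier adapted to an oblique direction -/

lemma hasGradientAt_quadratic {N : ℕ} {A : Euc N →L[ℝ] Euc N} (hA : ∀ z w, ⟪A z, w⟫ = ⟪z, A w⟫)
    (y x : Euc N) : HasGradientAt (fun x => ⟪A (x - y), x - y⟫) ((2 : ℝ) • A (x - y)) x := by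
  have h1 : HasFDerivAt (fun x : Euc N => x - y) (ContinuousLinearMap.id ℝ (Euc N)) x :=
    (hasFDerivAt_id x).sub_const y
  have h2 := (A.hasFDerivAt.comp x h1).inner ℝ h1
  rw [hasGradientAt_iff_hasFDerivAt]
  refine h2.congr_fderiv ?_
  ext w
  have h3 : ⟪A w, x - y⟫ = ⟪A (x - y), w⟫ := by rw [real_inner_comm, ← hA]
  simp only [fderivInnerCLM_apply, ContinuousLinearMap.comp_apply, ContinuousLinearMap.prod_apply,
    ContinuousLinearMap.id_apply, Function.comp_apply, InnerProductSpace.toDual_apply_apply,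
    real_inner_smul_left, h3]
  ring

lemma contDiff_quadratic {N : ℕ} (A : Euc N →L[ℝ] Euc N) (y : Euc N) :
    ContDiff ℝ 1 (fun x => ⟪A (x - y), x - y⟫) :=
  (A.contDiff.comp (contDiff_id.sub contDiff_const)).inner ℝ (contDiff_id.sub contDiff_const)

lemma exists_barrier {N : ℕ} {A : Euc N →L[ℝ] Euc N} (hA : ∀ z w, ⟪A z, w⟫ = ⟪z, A w⟫) {l : ℝ}
    (hl : 0 < l) (hpos : ∀ z, l * ‖z‖ ^ 2 ≤ ⟪A z, z⟫) (m x₀ : Euc N) {r : ℝ} (hr : 0 < r) :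
    ∃ ψ : Euc N → ℝ, ContDiff ℝ 1 ψ ∧
      (∀ x, HasGradientAt ψ (m + (2 * (‖m‖ + 1) / (l * r)) • A (x - x₀)) x) ∧ ψ x₀ = 0 ∧
      ∀ x, ‖x - x₀‖ = r → 0 < ψ x := by
  set k : ℝ := (‖m‖ + 1) / (l * r) with hk
  refine ⟨fun x => ⟪m, x⟫ - ⟪m, x₀⟫ + k * ⟪A (x - x₀), x - x₀⟫, ?_, fun x => ?_, by simp,
    fun x hx => ?_⟩
  · exact ((contDiff_const.inner ℝ contDiff_id).sub contDiff_const).add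
      (contDiff_const.mul (contDiff_quadratic A x₀))
  · have h1 : HasGradientAt (fun x : Euc N => ⟪m, x⟫) m x := by
      rw [hasGradientAt_iff_hasFDerivAt]
      exact (InnerProductSpace.toDual ℝ (Euc N) m).hasFDerivAt
    have h2 := (hasGradientAt_quadratic hA x₀ x).hasFDerivAt.const_mul k
    have h3 := (h1.hasFDerivAt.sub_const ⟪m, x₀⟫).add h2
    rw [hasGradientAt_iff_hasFDerivAt]
    refine h3.congr_fderiv ?_
    ext w
    simp only [hk, map_add, map_smul, add_apply,
      smul_apply, smul_eq_mul, InnerProductSpace.toDual_apply_apply]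
    ring
  · have h1 : -(‖m‖ * r) ≤ ⟪m, x - x₀⟫ := by
      have := (abs_le.1 (abs_real_inner_le_norm m (x - x₀))).1
      rwa [hx] at this
    have h2 := hpos (x - x₀)
    rw [hx] at h2
    have hk0 : 0 ≤ k := by positivity
    have h3 := mul_le_mul_of_nonneg_left h2 hk0
    have h4 : k * (l * r ^ 2) = (‖m‖ + 1) * r := by rw [hk]; field_simp
    rw [inner_sub_right] at h1
    dsimp only
    linarith

/-- A symmetric positive definite operator sending a given vector to a given covector, as soon as
their pairing is positive. -/
lemma exists_symm_pos_apply_eq {N : ℕ} {m p : Euc N} (hθ : 0 < ⟪p, m⟫) :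
    ∃ A : Euc N →L[ℝ] Euc N, (∀ z w, ⟪A z, w⟫ = ⟪z, A w⟫) ∧ A p = m ∧
      ∃ l > 0, ∀ z, l * ‖z‖ ^ 2 ≤ ⟪A z, z⟫ := by
  set θ : ℝ := ⟪p, m⟫ with hθdef
  let P : Euc N →L[ℝ] Euc N :=
    ContinuousLinearMap.id ℝ (Euc N) - (innerSL ℝ m).smulRight (θ⁻¹ • p)
  have hP : ∀ z, P z = z - (⟪m, z⟫ * θ⁻¹) • p := fun z => by simp [P, smul_smul]
  let A : Euc N →L[ℝ] Euc N :=
    (ContinuousLinearMap.adjoint P).comp P + (innerSL ℝ m).smulRight (θ⁻¹ • m)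
  have hAz : ∀ z, A z = ContinuousLinearMap.adjoint P (P z) + (⟪m, z⟫ * θ⁻¹) • m := fun z => by
    simp [A, smul_smul]
  have hAin : ∀ z w, ⟪A z, w⟫ = ⟪P z, P w⟫ + θ⁻¹ * (⟪m, z⟫ * ⟪m, w⟫) := fun z w => by
    rw [hAz, inner_add_left, ContinuousLinearMap.adjoint_inner_left, real_inner_smul_left]; ring
  have hpm : ⟪m, p⟫ = θ := by rw [real_inner_comm]
  refine ⟨A, fun z w => ?_, ?_, (2 + 2 * ‖p‖ ^ 2 / θ)⁻¹, by positivity, fun z => ?_⟩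
  · rw [real_inner_comm (A w) z, hAin, hAin, real_inner_comm (P z) (P w)]; ring
  · rw [hAz, hP, hpm, mul_inv_cancel₀ hθ.ne']; simp
  · rw [hAin, real_inner_self_eq_norm_sq, inv_mul_le_iff₀ (by positivity)]
    have h1 : ‖z‖ ≤ ‖P z‖ + |⟪m, z⟫| * θ⁻¹ * ‖p‖ := by
      have h2 : z = P z + (⟪m, z⟫ * θ⁻¹) • p := by rw [hP]; abel
      calc ‖z‖ = ‖P z + (⟪m, z⟫ * θ⁻¹) • p‖ := by rw [← h2]
        _ ≤ ‖P z‖ + ‖(⟪m, z⟫ * θ⁻¹) • p‖ := norm_add_le _ _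
        _ = _ := by
          rw [norm_smul, Real.norm_eq_abs, abs_mul, abs_of_pos (inv_pos.2 hθ)]
    set a := |⟪m, z⟫| * θ⁻¹ * ‖p‖ with ha
    have h3 : ‖z‖ ^ 2 ≤ 2 * ‖P z‖ ^ 2 + 2 * a ^ 2 := by
      have := pow_le_pow_left₀ (norm_nonneg z) h1 2
      nlinarith [sq_nonneg (‖P z‖ - a)]
    have h4 : 2 * a ^ 2 = (2 * ‖p‖ ^ 2 / θ) * (θ⁻¹ * (⟪m, z⟫ * ⟪m, z⟫)) := by
      rw [ha, mul_pow, mul_pow, sq_abs]; field_simp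
    have h5 : 0 ≤ (2 * ‖p‖ ^ 2 / θ) * ‖P z‖ ^ 2 := by positivity
    have h6 : 0 ≤ θ⁻¹ * (⟪m, z⟫ * ⟪m, z⟫) := mul_nonneg (inv_pos.2 hθ).le (mul_self_nonneg _)
    nlinarith

/-- At a boundary point of a `C¹` domain, a strictly outward direction pairs positively with the
gradient of a defining function. -/
lemma HasC1Boundary.exists_conormal {N : ℕ} {Ω : Set (Euc N)} (hC1 : HasC1Boundary Ω)
    (hΩ : IsOpen Ω) {x₀ n₀ p : Euc N} (hx₀ : x₀ ∈ frontier Ω) (hn : IsOuterUnitNormalAt Ω x₀ n₀)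
    (hp : 0 < ⟪p, n₀⟫) :
    ∃ m : Euc N, 0 < ⟪p, m⟫ ∧ ∀ e > 0, ∃ r > 0, ∀ x ∈ frontier Ω, x ∈ ball x₀ r →
      ∀ y ∈ closure Ω, y ∈ ball x₀ r → -(e * ‖x - y‖) ≤ ⟪m, x - y⟫ := by
  obtain ⟨ν, r₀, G, hν, hr₀, hG, hGν, hΩG⟩ := hC1.exists_defining hx₀
  have hGc := hG.continuous
  have hG0 : G x₀ = 0 :=
    eq_zero_of_mem_frontier_of_defining hΩ hGc hΩG hx₀ (mem_ball_self hr₀)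
  have hst : HasStrictFDerivAt G (fderiv ℝ G x₀) x₀ :=
    hG.contDiffAt.hasStrictFDerivAt one_ne_zero
  obtain ⟨m, hm⟩ : ∃ m, InnerProductSpace.toDual ℝ (Euc N) m = fderiv ℝ G x₀ :=
    (InnerProductSpace.toDual ℝ (Euc N)).surjective _
  have hmv : ∀ z, fderiv ℝ G x₀ z = ⟪m, z⟫ := fun z => by
    rw [← hm, InnerProductSpace.toDual_apply_apply]
  have hdir : ∀ h : Euc N, HasDerivAt (fun a : ℝ => G (x₀ + a • h)) ⟪m, h⟫ 0 := fun h => by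
    have h1 : HasDerivAt (fun a : ℝ => x₀ + a • h) h 0 := by
      simpa using ((hasDerivAt_id (0 : ℝ)).smul_const h).const_add x₀
    have h2 : HasFDerivAt G (fderiv ℝ G x₀) (x₀ + (0 : ℝ) • h) := by
      simpa using hst.hasFDerivAt
    have h3 := h2.comp_hasDerivAt (0 : ℝ) h1
    rwa [hmv] at h3
  have hmν : ⟪m, ν⟫ = -1 := by
    have h1 : (fun a : ℝ => G (x₀ + a • ν)) = fun a => G x₀ - a := funext fun a => hGν x₀ a
    have h2 := hdir ν
    rw [h1] at h2
    have h3 : HasDerivAt (fun a : ℝ => G x₀ - a) (-1) 0 := by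
      simpa using (hasDerivAt_id (0 : ℝ)).const_sub (G x₀)
    exact h2.unique h3
  -- directions with negative pairing enter the domain
  have hin : ∀ h : Euc N, ⟪m, h⟫ < 0 → ⟪h, n₀⟫ ≤ 0 := by
    intro h hh
    have h1 : ∀ᶠ a in 𝓝[>] (0 : ℝ), x₀ + a • h ∈ Ω := by
      have hc : Tendsto (fun a : ℝ => x₀ + a • h) (𝓝[>] 0) (𝓝 x₀) := by
        have : Continuous (fun a : ℝ => x₀ + a • h) := by fun_prop
        simpa using (this.tendsto 0).mono_left nhdsWithin_le_nhds
      have hneg : ∀ᶠ a in 𝓝[>] (0 : ℝ), G (x₀ + a • h) < 0 := by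
        have h2 := (hdir h).tendsto_slope_zero_right.eventually_lt_const hh
        filter_upwards [h2, self_mem_nhdsWithin] with a ha ha0
        have ha0 : 0 < a := ha0
        simp only [zero_add, zero_smul, add_zero, hG0, sub_zero, smul_eq_mul] at ha
        exact (pos_iff_neg_of_mul_neg ha).1 (inv_pos.2 ha0)
      filter_upwards [hneg, hc.eventually (ball_mem_nhds x₀ hr₀)] with a ha hb
      exact (hΩG _ hb).2 ha
    refine le_of_forall_pos_le_add fun e he => ?_
    obtain ⟨d, hd, hd'⟩ := hn.2 (e / (‖h‖ + 1)) (by positivity)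
    have h2 : ∀ᶠ a in 𝓝[>] (0 : ℝ), ‖a • h‖ < d := by
      have : Continuous (fun a : ℝ => ‖a • h‖) := by fun_prop
      have := (this.tendsto 0).mono_left (nhdsWithin_le_nhds (s := Ioi 0))
      simp only [zero_smul, norm_zero] at this
      exact this.eventually_lt_const hd
    obtain ⟨a, ⟨ha1, ha2⟩, ha0⟩ := ((h1.and h2).and self_mem_nhdsWithin).exists
    have ha0 : 0 < a := ha0
    have h3 := hd' _ (subset_closure ha1) (by simpa using ha2)
    rw [add_sub_cancel_left, real_inner_smul_left, norm_smul, Real.norm_of_nonneg ha0.le] at h3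
    have h4 : ⟪h, n₀⟫ ≤ e / (‖h‖ + 1) * ‖h‖ := by
      refine le_of_mul_le_mul_left ?_ ha0
      linarith
    have h5 : e / (‖h‖ + 1) * ‖h‖ ≤ e := by
      rw [div_mul_eq_mul_div, div_le_iff₀ (by positivity)]; nlinarith
    linarith
  refine ⟨m, ?_, fun e he => ?_⟩
  · by_contra! hle
    refine hp.not_ge (le_of_forall_pos_le_add fun e he => ?_)
    set s : ℝ := e / (‖n₀‖ + 1) with hs
    have hs0 : 0 < s := by positivity
    have h1 := hin (p + s • ν) (by
      rw [inner_add_right, real_inner_smul_right, hmν, real_inner_comm]; linarith)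
    rw [inner_add_left, real_inner_smul_left] at h1
    have h2 := (abs_le.1 (abs_real_inner_le_norm ν n₀)).1
    rw [hν, hn.1] at h2
    have h3 : s ≤ e := by
      rw [hs, hn.1]; linarith
    nlinarith
  · have h1 := hst.isLittleO.def he
    obtain ⟨r₁, hr₁, hr₁s⟩ := Metric.mem_nhds_iff.1 h1
    refine ⟨min r₀ r₁, lt_min hr₀ hr₁, fun x hx hxr y hy hyr => ?_⟩
    have hx1 := ball_subset_ball (min_le_left r₀ r₁) hxr
    have hy1 := ball_subset_ball (min_le_left r₀ r₁) hyr
    have h2 : (x, y) ∈ ball (x₀, x₀) r₁ := by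
      rw [← ball_prod_same]
      exact ⟨ball_subset_ball (min_le_right r₀ r₁) hxr, ball_subset_ball (min_le_right r₀ r₁) hyr⟩
    have h3 : ‖G x - G y - fderiv ℝ G x₀ (x - y)‖ ≤ e * ‖x - y‖ := hr₁s h2
    rw [hmv, eq_zero_of_mem_frontier_of_defining hΩ hGc hΩG hx hx1, Real.norm_eq_abs] at h3
    have h4 := nonpos_of_mem_closure_of_defining hGc hΩG hy hy1
    have h5 := (abs_le.1 h3).2
    linarith

/-- Local data at a point of `closure Ω`: a quadratic penalisation `A`, a linear correction `q` and
the slope `m` of a barrier for which the test gradients strictly violate the oblique boundary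
conditions. -/
lemma exists_local_data {N : ℕ} {Ω : Set (Euc N)} {γ n : Euc N → Euc N} {g : Euc N → ℝ}
    (hΩ : IsOpen Ω) (hC1 : HasC1Boundary Ω) (hγ : ContinuousOn γ (closure Ω))
    (hg : ContinuousOn g (frontier Ω)) (hn : ∀ x ∈ frontier Ω, IsOuterUnitNormalAt Ω x (n x))
    (hobl : ∀ x ∈ frontier Ω, 0 < ⟪γ x, n x⟫) {x₀ : Euc N} (hx₀ : x₀ ∈ closure Ω) :
    ∃ (A : Euc N →L[ℝ] Euc N) (m q : Euc N) (l : ℝ), (∀ z w, ⟪A z, w⟫ = ⟪z, A w⟫) ∧ 0 < l ∧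
      (∀ z, l * ‖z‖ ^ 2 ≤ ⟪A z, z⟫) ∧
      ∀ P ≥ 0, ∀ δ > 0, ∀ ρ > 0, ∃ r > 0, r < ρ ∧ ∀ x ∈ frontier Ω, ‖x - x₀‖ ≤ r →
        ∀ y ∈ closure Ω, ‖y - x₀‖ ≤ r → ∀ β ≥ 0, β * ‖x - y‖ ≤ P →
          |⟪γ x, q⟫ - g x| <
            β * ⟪γ x, A (x - y)⟫ +
              δ * ⟪γ x, m + (2 * (‖m‖ + 1) / (l * r)) • A (x - x₀)⟫ := by
  rcases mem_or_mem_frontier_of_mem_closure hΩ hx₀ with h0 | h0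
  · refine ⟨ContinuousLinearMap.id ℝ (Euc N), 0, 0, 1, fun z w => rfl, one_pos, fun z => ?_,
      fun P _ δ _ ρ hρ => ?_⟩
    · simp
    · obtain ⟨r, hr, hball⟩ := Metric.isOpen_iff.1 hΩ x₀ h0
      refine ⟨min r ρ / 2, by positivity, ?_, fun x hx hxr => ?_⟩
      · linarith [min_le_right r ρ]
      · rw [hΩ.frontier_eq] at hx
        refine absurd (hball ?_) hx.2
        rw [mem_ball, dist_eq_norm]
        have : 0 < min r ρ := lt_min hr hρ
        linarith [min_le_left r ρ]
  obtain ⟨m, hm, hmG⟩ := hC1.exists_conormal hΩ h0 (hn x₀ h0) (hobl x₀ h0)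
  obtain ⟨A, hA, hAm, l, hl, hpos⟩ := exists_symm_pos_apply_eq hm
  set θ := ⟪γ x₀, m⟫ with hθ
  set q : Euc N := (g x₀ / θ) • m with hq
  refine ⟨A, m, q, l, hA, hl, hpos, fun P hP δ hδ ρ hρ => ?_⟩
  set c : ℝ := 2 * (‖m‖ + 1) / l with hc
  have hc0 : 0 ≤ c := by positivity
  set B : ℝ := P * (1 + ‖A‖) + 1 + δ * (‖m‖ + c * ‖A‖ + c) with hB
  have hB0 : 0 < B := by positivity
  set e : ℝ := δ * θ / (2 * B) with he
  have he0 : 0 < e := by positivity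
  have heB : e * B < δ * θ := by
    have h1 : e * B = δ * θ / 2 := by rw [he]; field_simp
    have : 0 < δ * θ := by positivity
    linarith
  obtain ⟨r₁, hr₁, hG⟩ := hmG e he0
  have hq0 : ⟪γ x₀, q⟫ - g x₀ = 0 := by
    rw [hq, real_inner_smul_right, ← hθ, div_mul_cancel₀ _ hm.ne', sub_self]
  obtain ⟨r₂, hr₂, hγ₂⟩ := Metric.continuousWithinAt_iff.1 (hγ x₀ hx₀) e he0
  have hgc : ContinuousWithinAt (fun x => ⟪γ x, q⟫ - g x) (frontier Ω) x₀ :=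
    (((hγ x₀ hx₀).mono frontier_subset_closure).inner continuousWithinAt_const).sub (hg x₀ h0)
  obtain ⟨r₃, hr₃, hg₃⟩ := Metric.continuousWithinAt_iff.1 hgc e he0
  set r : ℝ := min (min ρ r₁) (min r₂ r₃) / 2 with hr
  have hmin : 0 < min (min ρ r₁) (min r₂ r₃) := by positivity
  have hr0 : 0 < r := by positivity
  have hrρ : r < ρ := by
    linarith [min_le_left (min ρ r₁) (min r₂ r₃), min_le_left ρ r₁]
  have hrr₁ : r < r₁ := by
    linarith [min_le_left (min ρ r₁) (min r₂ r₃), min_le_right ρ r₁]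
  have hrr₂ : r < r₂ := by
    linarith [min_le_right (min ρ r₁) (min r₂ r₃), min_le_left r₂ r₃]
  have hrr₃ : r < r₃ := by
    linarith [min_le_right (min ρ r₁) (min r₂ r₃), min_le_right r₂ r₃]
  refine ⟨r, hr0, hrρ, fun x hx hxr y hy hyr β hβ hβP => ?_⟩
  have hxcl := frontier_subset_closure hx
  have hγx : ‖γ x - γ x₀‖ ≤ e := by
    rw [← dist_eq_norm]
    exact (hγ₂ hxcl (by rw [dist_eq_norm]; linarith)).le
  have hgx : |⟪γ x, q⟫ - g x| ≤ e := by
    have := (hg₃ hx (by rw [dist_eq_norm]; linarith)).le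
    rwa [hq0, Real.dist_eq, sub_zero] at this
  have hball : ∀ z, ‖z - x₀‖ ≤ r → z ∈ ball x₀ r₁ := fun z hz => by
    rw [mem_ball, dist_eq_norm]; linarith
  have hγA : ∀ z, ⟪γ x₀, A z⟫ = ⟪m, z⟫ := fun z => by rw [← hA, hAm]
  have herr : ∀ z, -(e * ‖z‖) ≤ ⟪γ x - γ x₀, z⟫ := fun z => by
    have h1 := (abs_le.1 (abs_real_inner_le_norm (γ x - γ x₀) z)).1
    have h2 := mul_le_mul_of_nonneg_right hγx (norm_nonneg z)
    linarith
  have hsplit : ∀ z, ⟪γ x, z⟫ = ⟪γ x₀, z⟫ + ⟪γ x - γ x₀, z⟫ := fun z => by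
    rw [inner_sub_left]; ring
  -- quadratic part
  have k1 : -(e * (P * (1 + ‖A‖))) ≤ β * ⟪γ x, A (x - y)⟫ := by
    rw [hsplit, hγA]
    have h1 := hG x hx (hball x hxr) y hy (hball y hyr)
    have h2 := herr (A (x - y))
    have h3 := mul_le_mul_of_nonneg_left (A.le_opNorm (x - y)) he0.le
    have h4 : -(e * ((1 + ‖A‖) * ‖x - y‖)) ≤ ⟪m, x - y⟫ + ⟪γ x - γ x₀, A (x - y)⟫ := by
      linarith
    have h5 := mul_le_mul_of_nonneg_left h4 hβ
    have h6 : e * (1 + ‖A‖) * (β * ‖x - y‖) ≤ e * (1 + ‖A‖) * P :=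
      mul_le_mul_of_nonneg_left hβP (by positivity)
    linarith
  -- barrier part
  set b : ℝ := 2 * (‖m‖ + 1) / (l * r) with hb
  have hb0 : 0 ≤ b := by positivity
  have hbr : b * r = c := by rw [hb, hc]; field_simp
  have hbx : b * ‖x - x₀‖ ≤ c := by
    rw [← hbr]; exact mul_le_mul_of_nonneg_left hxr hb0
  have k2 : θ - e * (‖m‖ + c * ‖A‖ + c) ≤ ⟪γ x, m + b • A (x - x₀)⟫ := by
    rw [hsplit, inner_add_right (γ x₀), real_inner_smul_right, hγA, ← hθ]
    have h1 := hG x hx (hball x hxr) x₀ hx₀ (hball x₀ (by simpa using hr0.le))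
    have h2 := herr (m + b • A (x - x₀))
    have h3 : ‖m + b • A (x - x₀)‖ ≤ ‖m‖ + c * ‖A‖ := by
      refine (norm_add_le _ _).trans (add_le_add_right ?_ _)
      rw [norm_smul, Real.norm_of_nonneg hb0]
      have h4 := mul_le_mul_of_nonneg_left (A.le_opNorm (x - x₀)) hb0
      have h5 := mul_le_mul_of_nonneg_right hbx (norm_nonneg A)
      linarith
    have h6 := mul_le_mul_of_nonneg_left h3 he0.le
    have h7 := mul_le_mul_of_nonneg_left h1 hb0
    have h8 := mul_le_mul_of_nonneg_left hbx he0.le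
    linarith
  have k3 := mul_le_mul_of_nonneg_left k2 hδ.le
  have k4 : e * B = e * (P * (1 + ‖A‖)) + e + δ * (e * (‖m‖ + c * ‖A‖ + c)) := by rw [hB]; ring
  linarith

/-! ### Viscosity inequalities at a maximum of the penalised function -/

lemma hasGradientAt_penalty {N : ℕ} {A : Euc N →L[ℝ] Euc N} (hA : ∀ z w, ⟪A z, w⟫ = ⟪z, A w⟫)
    {ψ : Euc N → ℝ} {D x : Euc N} (hψ : HasGradientAt ψ D x) (a d : ℝ) (q y : Euc N) :
    HasGradientAt (fun x => a / 2 * ⟪A (x - y), x - y⟫ + ⟪q, x⟫ + d * ψ x)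
      (a • A (x - y) + q + d • D) x := by
  have h1 : HasFDerivAt (fun x : Euc N => ⟪q, x⟫) (InnerProductSpace.toDual ℝ (Euc N) q) x :=
    (InnerProductSpace.toDual ℝ (Euc N) q).hasFDerivAt
  have h2 := (hasGradientAt_quadratic hA y x).hasFDerivAt.const_mul (a / 2)
  rw [hasGradientAt_iff_hasFDerivAt]
  refine ((h2.add h1).add (hψ.hasFDerivAt.const_mul d)).congr_fderiv ?_
  ext w
  simp only [map_add, map_smul, add_apply, smul_apply, smul_eq_mul,
    InnerProductSpace.toDual_apply_apply]
  ring

lemma contDiff_penalty {N : ℕ} (A : Euc N →L[ℝ] Euc N) {ψ : Euc N → ℝ} (hψ : ContDiff ℝ 1 ψ)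
    (a d : ℝ) (q y : Euc N) :
    ContDiff ℝ 1 (fun x => a / 2 * ⟪A (x - y), x - y⟫ + ⟪q, x⟫ + d * ψ x) :=
  ((contDiff_const.mul (contDiff_quadratic A y)).add
    (contDiff_const.inner ℝ contDiff_id)).add (contDiff_const.mul hψ)

lemma IsCNSub.le_of_penalised_max {N : ℕ} {Ω : Set (Euc N)} {H : Euc N → Euc N → ℝ}
    {γ : Euc N → Euc N} {g : Euc N → ℝ} {u : Euc N × ℝ → ℝ} (hΩ : IsOpen Ω)
    (hu : IsCNSub Ω H γ g u) {A : Euc N →L[ℝ] Euc N} (hA : ∀ z w, ⟪A z, w⟫ = ⟪z, A w⟫)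
    {ψ : Euc N → ℝ} (hψ : ContDiff ℝ 1 ψ) {x₀ x y q D : Euc N} (hD : HasGradientAt ψ D x)
    {β δ ε r s t T : ℝ} (hx : x ∈ closure Ω) (hxr : ‖x - x₀‖ < r) (ht : 0 < t) (htT : t < T)
    (hmax : ∀ x' ∈ closure Ω, ‖x' - x₀‖ ≤ r → ∀ t' ∈ Icc 0 T,
      u (x', t') - (t' - s) ^ 2 / ε - β / 2 * ⟪A (x' - y), x' - y⟫ - ⟪q, x'⟫ - δ * ψ x' ≤
        u (x, t) - (t - s) ^ 2 / ε - β / 2 * ⟪A (x - y), x - y⟫ - ⟪q, x⟫ - δ * ψ x)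
    (hbd : x ∈ frontier Ω → 0 < ⟪γ x, β • A (x - y) + q + δ • D⟫ - g x) :
    2 * (t - s) / ε + H x (β • A (x - y) + q + δ • D) ≤ 0 := by
  refine hu.test (h := fun t' => (t' - s) ^ 2 / ε) hΩ (contDiff_penalty A hψ β δ q y)
    (by fun_prop) hx ht
    (hasGradientAt_penalty hA hD β δ q y) ?_ ?_ hbd
  · have := (((hasDerivAt_id t).sub_const s).pow 2).div_const ε
    simpa using this
  · have h1 : ∀ᶠ p : Euc N × ℝ in 𝓝 (x, t), ‖p.1 - x₀‖ < r ∧ p.2 < T := by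
      have c1 : Continuous (fun p : Euc N × ℝ => ‖p.1 - x₀‖) := by fun_prop
      exact ((c1.tendsto (x, t)).eventually_lt_const hxr).and
        ((continuous_snd.tendsto (x, t)).eventually_lt_const htT)
    filter_upwards [nhdsWithin_le_nhds h1, self_mem_nhdsWithin] with p hp hp'
    have := hmax p.1 hp'.1 hp.1.le p.2 ⟨(mem_Ioi.1 hp'.2).le, hp.2.le⟩
    linarith

lemma IsCNSuper.ge_of_penalised_max {N : ℕ} {Ω : Set (Euc N)} {H : Euc N → Euc N → ℝ}
    {γ : Euc N → Euc N} {g : Euc N → ℝ} {v : Euc N × ℝ → ℝ} (hΩ : IsOpen Ω)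
    (hv : IsCNSuper Ω H γ g v) {A : Euc N →L[ℝ] Euc N} (hA : ∀ z w, ⟪A z, w⟫ = ⟪z, A w⟫)
    {ψ : Euc N → ℝ} (hψ : ContDiff ℝ 1 ψ) {χ : ℝ → ℝ} (hχ : ContDiff ℝ 1 χ)
    {x₀ x y q D : Euc N} (hD : HasGradientAt ψ D y)
    {β δ ε r s t T χ' : ℝ} (hχ' : HasDerivAt χ χ' s)
    (hy : y ∈ closure Ω) (hyr : ‖y - x₀‖ < r) (hs : 0 < s) (hsT : s < T)
    (hmax : ∀ y' ∈ closure Ω, ‖y' - x₀‖ ≤ r → ∀ s' ∈ Icc 0 T,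
      -v (y', s') - (t - s') ^ 2 / ε - χ s' - β / 2 * ⟪A (x - y'), x - y'⟫ + ⟪q, y'⟫ - δ * ψ y' ≤
        -v (y, s) - (t - s) ^ 2 / ε - χ s - β / 2 * ⟪A (x - y), x - y⟫ + ⟪q, y⟫ - δ * ψ y)
    (hbd : y ∈ frontier Ω → ⟪γ y, β • A (x - y) + q - δ • D⟫ - g y < 0) :
    0 ≤ 2 * (t - s) / ε - χ' + H y (β • A (x - y) + q - δ • D) := by
  have hflip : (-β) • A (y - x) + q + (-δ) • D = β • A (x - y) + q - δ • D := by
    rw [← neg_sub x y, map_neg]; module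
  have hneg : ∀ y', ⟪A (x - y'), x - y'⟫ = ⟪A (y' - x), y' - x⟫ := fun y' => by
    rw [← neg_sub y' x, map_neg, inner_neg_neg]
  refine hv.test (h := fun s' => -((t - s') ^ 2 / ε) - χ s') hΩ
    (contDiff_penalty A hψ (-β) (-δ) q x) (by fun_prop) hy hs
    (hflip ▸ hasGradientAt_penalty hA hD (-β) (-δ) q x) ?_ ?_ hbd
  · have h1 := ((((hasDerivAt_id s).const_sub t).pow 2).div_const ε).neg.sub hχ'
    refine h1.congr_deriv ?_
    simp
    ring
  · have h1 : ∀ᶠ p : Euc N × ℝ in 𝓝 (y, s), ‖p.1 - x₀‖ < r ∧ p.2 < T := by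
      have c1 : Continuous (fun p : Euc N × ℝ => ‖p.1 - x₀‖) := by fun_prop
      exact ((c1.tendsto (y, s)).eventually_lt_const hyr).and
        ((continuous_snd.tendsto (y, s)).eventually_lt_const hsT)
    filter_upwards [nhdsWithin_le_nhds h1, self_mem_nhdsWithin] with p hp hp'
    have := hmax p.1 hp'.1 hp.1.le p.2 ⟨(mem_Ioi.1 hp'.2).le, hp.2.le⟩
    rw [hneg, hneg] at this
    linarith

/-- If the sup-convolution in time of a subsolution attains its suprema in the open time interval,
it is Lipschitz near each point of `closure Ω`, uniformly in the parameter. -/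
lemma exists_lipschitz_timeSup {N : ℕ} {Ω : Set (Euc N)} {H : Euc N → Euc N → ℝ}
    {u : Euc N × ℝ → ℝ} (hΩ : IsOpen Ω) (hK : IsCompact (closure Ω)) (hC1 : HasC1Boundary Ω)
    (hcoer : Coercive Ω H) (hu : ContinuousOn u (closure Ω ×ˢ Ici 0)) (hsub : ParSubOn H u Ω)
    {T ε a b : ℝ} (hT : 0 ≤ T) (hε : 0 < ε) (hbT : b ≤ T)
    (hint : ∀ s ∈ Icc a b, ∀ x ∈ Ω, ∀ t ∈ Icc 0 T,
      timeSup u T ε s x = u (x, t) - (t - s) ^ 2 / ε → 0 < t ∧ t < T)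
    {x₀ : Euc N} (hx₀ : x₀ ∈ closure Ω) :
    ∃ r > 0, ∃ L ≥ 0, ∀ s ∈ Icc a b, ∀ x ∈ closure Ω, x ∈ ball x₀ r → ∀ y ∈ closure Ω,
      y ∈ ball x₀ r → timeSup u T ε s x - timeSup u T ε s y ≤ L * ‖x - y‖ := by
  obtain ⟨r, hr, C, hC, hlip⟩ := hC1.exists_lipschitz_of_slope hΩ hx₀
  obtain ⟨R₀, hR₀⟩ := hcoer (2 * T / ε + 1)
  set R := max R₀ 1 with hRdef
  have hR : 0 < R := lt_max_of_lt_right one_pos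
  refine ⟨r, hr, C * (2 * R), by positivity, fun s hs x hx hxr y hy hyr => ?_⟩
  refine hlip _ (2 * R) (by positivity) (continuousOn_timeSup hK hu hT) (fun z hz r' hr' => ?_)
    x hx hxr y hy hyr
  refine hsub.timeSup_slope hΩ hK hu hT hε (hs.2.trans hbT) hR (fun x hx p hp => ?_) (hint s hs)
    hz hr'
  have := hR₀ x (subset_closure hx) p ((le_max_left _ _).trans hp)
  linarith

/-! ### The doubling of variables -/

section Doubling

variable {N : ℕ} {K : Set (Euc N)} {u v : Euc N × ℝ → ℝ}

lemma upperSemicontinuousOn_doubled (hu : ContinuousOn u (K ×ˢ Ici 0))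
    (hv : LowerSemicontinuousOn v (K ×ˢ Ici 0)) {S : Set (Euc N × Euc N × ℝ × ℝ)}
    (hS : ∀ z ∈ S, z.1 ∈ K ∧ z.2.1 ∈ K ∧ 0 ≤ z.2.2.1 ∧ 0 ≤ z.2.2.2)
    {F : Euc N × Euc N × ℝ × ℝ → ℝ} (hF : ContinuousOn F S) :
    UpperSemicontinuousOn (fun z => u (z.1, z.2.2.1) - F z - v (z.2.1, z.2.2.2)) S := by
  refine upperSemicontinuousOn_sub_comp (pr := fun z : Euc N × Euc N × ℝ × ℝ => (z.2.1, z.2.2.2))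
    (F := fun z => u (z.1, z.2.2.1) - F z) hv (by fun_prop) (fun z hz => ?_) ?_
  · exact ⟨(hS z hz).2.1, (hS z hz).2.2.2⟩
  · refine ContinuousOn.sub ?_ hF
    exact hu.comp (f := fun z : Euc N × Euc N × ℝ × ℝ => (z.1, z.2.2.1)) (by fun_prop)
      fun z hz => ⟨(hS z hz).1, (hS z hz).2.2.1⟩

lemma exists_initial_gap (hK : IsCompact K) (hu : ContinuousOn u (K ×ˢ Ici 0))
    (hv : LowerSemicontinuousOn v (K ×ˢ Ici 0)) (hinit : ∀ x ∈ K, u (x, 0) ≤ v (x, 0)) {c : ℝ}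
    (hc : 0 < c) : ∃ τ, 0 < τ ∧ τ ≤ 1 ∧ ∀ x ∈ K, ∀ y ∈ K, ∀ t ≥ 0, ∀ s ≥ 0,
      ‖x - y‖ + t + s < τ → u (x, t) - v (y, s) < c := by
  have husc := upperSemicontinuousOn_doubled hu hv (S := K ×ˢ K ×ˢ Icc 0 1 ×ˢ Icc 0 1)
    (fun z hz => ⟨hz.1, hz.2.1, hz.2.2.1.1, hz.2.2.2.1⟩) (F := fun _ => 0) continuousOn_const
  obtain ⟨m, hm, h⟩ := exists_pos_forall_lt_of_upperSemicontinuousOn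
    (hK.prod (hK.prod (isCompact_Icc.prod isCompact_Icc))) husc
    (d := fun z => ‖z.1 - z.2.1‖ + z.2.2.1 + z.2.2.2) (c := c) (by fun_prop) (by
      rintro ⟨x, y, t, s⟩ ⟨hx, hy, ht, hs⟩ hd
      dsimp only at hx hy ht hs hd ⊢
      have h0 := norm_nonneg (x - y)
      have ht0 : t = 0 := le_antisymm (by linarith [hs.1]) ht.1
      have hs0 : s = 0 := le_antisymm (by linarith [ht.1]) hs.1
      have hxy : x = y := by
        rw [← sub_eq_zero, ← norm_le_zero_iff]; linarith [ht.1, hs.1]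
      subst ht0 hs0 hxy
      linarith [hinit x hx])
  refine ⟨min m 1, lt_min hm one_pos, min_le_right _ _, fun x hx y hy t ht s hs hd => ?_⟩
  have h0 := norm_nonneg (x - y)
  have h1 := min_le_right m 1
  have := h (x, y, t, s) ⟨hx, hy, ⟨ht, by linarith⟩, ⟨hs, by linarith⟩⟩
    (hd.trans_le (min_le_left _ _))
  simpa using this

/-- Penalised doubling of the variables around a diagonal maximum point, localised by a barrier. -/
lemma exists_penalised_max (hK : IsCompact K) (hu : ContinuousOn u (K ×ˢ Ici 0))
    (hv : LowerSemicontinuousOn v (K ×ˢ Ici 0)) {T T' ε : ℝ} {χ : ℝ → ℝ} (hχ : Continuous χ)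
    {x₀ : Euc N} {t₀ s₀ : ℝ} (hx₀ : x₀ ∈ K) (ht₀ : t₀ ∈ Icc 0 T') (hs₀ : s₀ ∈ Icc 0 T)
    (hdiag : ∀ x ∈ K, ∀ t ∈ Icc 0 T', ∀ s ∈ Icc 0 T,
      u (x, t) - v (x, s) - (t - s) ^ 2 / ε - χ s ≤
        u (x₀, t₀) - v (x₀, s₀) - (t₀ - s₀) ^ 2 / ε - χ s₀)
    {A : Euc N →L[ℝ] Euc N} {l : ℝ} (hl : 0 < l) (hpos : ∀ z, l * ‖z‖ ^ 2 ≤ ⟪A z, z⟫)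
    (q : Euc N) {ψ : Euc N → ℝ} (hψ : Continuous ψ) (hψ₀ : ψ x₀ = 0) {r δ d : ℝ} (hr : 0 < r)
    (hψr : ∀ x, ‖x - x₀‖ = r → 0 < ψ x) (hδ : 0 < δ) (hd : 0 < d) :
    ∃ β > 0, ∃ x ∈ K, ∃ y ∈ K, ∃ t ∈ Icc 0 T', ∃ s ∈ Icc 0 T, ‖x - x₀‖ < r ∧ ‖y - x₀‖ < r ∧
      ‖x - y‖ < d ∧
      u (x₀, t₀) - v (x₀, s₀) - (t₀ - s₀) ^ 2 / ε - χ s₀ ≤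
        u (x, t) - v (y, s) - (t - s) ^ 2 / ε - χ s - β / 2 * ⟪A (x - y), x - y⟫
            - ⟪q, x - y⟫ - δ * ψ x - δ * ψ y ∧
      ∀ x' ∈ K, ‖x' - x₀‖ ≤ r → ∀ y' ∈ K, ‖y' - x₀‖ ≤ r → ∀ t' ∈ Icc 0 T', ∀ s' ∈ Icc 0 T,
        u (x', t') - v (y', s') - (t' - s') ^ 2 / ε - χ s' - β / 2 * ⟪A (x' - y'), x' - y'⟫
            - ⟪q, x' - y'⟫ - δ * ψ x' - δ * ψ y' ≤
          u (x, t) - v (y, s) - (t - s) ^ 2 / ε - χ s - β / 2 * ⟪A (x - y), x - y⟫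
            - ⟪q, x - y⟫ - δ * ψ x - δ * ψ y := by
  set M₀ := u (x₀, t₀) - v (x₀, s₀) - (t₀ - s₀) ^ 2 / ε - χ s₀ with hM₀
  set B : Set (Euc N) := K ∩ {x | ‖x - x₀‖ ≤ r} with hB
  have hBc : IsCompact B := hK.inter_right (isClosed_le (by fun_prop) continuous_const)
  set S : Set (Euc N × Euc N × ℝ × ℝ) := B ×ˢ B ×ˢ Icc 0 T' ×ˢ Icc 0 T with hSdef
  have hS : IsCompact S := hBc.prod (hBc.prod (isCompact_Icc.prod isCompact_Icc))
  have hSK : ∀ z ∈ S, z.1 ∈ K ∧ z.2.1 ∈ K ∧ 0 ≤ z.2.2.1 ∧ 0 ≤ z.2.2.2 := fun z hz =>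
    ⟨hz.1.1, hz.2.1.1, hz.2.2.1.1, hz.2.2.2.1⟩
  have hz₀ : (x₀, x₀, t₀, s₀) ∈ S := by
    have : x₀ ∈ B := ⟨hx₀, by simpa using hr.le⟩
    exact ⟨this, this, ht₀, hs₀⟩
  let F : Euc N × Euc N × ℝ × ℝ → ℝ := fun z => (z.2.2.1 - z.2.2.2) ^ 2 / ε + χ z.2.2.2
    + ⟪q, z.1 - z.2.1⟫ + δ * ψ z.1 + δ * ψ z.2.1
  have hF : Continuous F := by fun_prop
  have husc := upperSemicontinuousOn_doubled hu hv hSK hF.continuousOn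
  -- strict inequality on the lateral boundary
  obtain ⟨m, hm, hlat⟩ : ∃ m > 0, ∀ z ∈ S ∩ {z | ‖z.1 - x₀‖ = r ∨ ‖z.2.1 - x₀‖ = r},
      ‖z.1 - z.2.1‖ < m → u (z.1, z.2.2.1) - F z - v (z.2.1, z.2.2.2) < M₀ := by
    refine exists_pos_forall_lt_of_upperSemicontinuousOn
      (hS.inter_right ?_) (husc.mono inter_subset_left) (by fun_prop) ?_
    · exact (isClosed_eq (by fun_prop) continuous_const).union
        (isClosed_eq (by fun_prop) continuous_const)
    · rintro ⟨x, y, t, s⟩ ⟨⟨hx, hy, ht, hs⟩, hlat⟩ hxy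
      have hxy : x = y := by rw [← sub_eq_zero, ← norm_le_zero_iff]; exact hxy
      subst hxy
      have h1 : 0 < ψ x := hψr x (by simpa using hlat)
      have h2 := hdiag x hx.1 t ht s hs
      have h3 := mul_pos hδ h1
      simp only [F, sub_self, inner_zero_right]
      linarith
  obtain ⟨zC, -, hzC⟩ := husc.exists_isMaxOn ⟨_, hz₀⟩ hS
  set C := u (zC.1, zC.2.2.1) - F zC - v (zC.2.1, zC.2.2.2) with hC
  have hCmax : ∀ z ∈ S, u (z.1, z.2.2.1) - F z - v (z.2.1, z.2.2.2) ≤ C := fun z hz => hzC hz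
  have hMC : M₀ ≤ C := by
    have := hCmax _ hz₀
    simp only [F, sub_self, inner_zero_right, hψ₀] at this
    linarith
  set d' := min m d with hd'
  have hd'0 : 0 < d' := lt_min hm hd
  set β : ℝ := 2 * (C - M₀ + 1) / (l * d' ^ 2) with hβ
  have hβ0 : 0 < β := by
    have : 0 < C - M₀ + 1 := by linarith
    positivity
  have hβd : β / 2 * (l * d' ^ 2) = C - M₀ + 1 := by rw [hβ]; field_simp
  have husc' := upperSemicontinuousOn_doubled hu hv hSK
    (F := fun z => F z + β / 2 * ⟪A (z.1 - z.2.1), z.1 - z.2.1⟫) (by fun_prop)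
  obtain ⟨⟨x, y, t, s⟩, ⟨hx, hy, ht, hs⟩, hmax⟩ := husc'.exists_isMaxOn ⟨_, hz₀⟩ hS
  have hmax' : ∀ x' ∈ K, ‖x' - x₀‖ ≤ r → ∀ y' ∈ K, ‖y' - x₀‖ ≤ r → ∀ t' ∈ Icc 0 T',
      ∀ s' ∈ Icc 0 T,
        u (x', t') - v (y', s') - (t' - s') ^ 2 / ε - χ s' - β / 2 * ⟪A (x' - y'), x' - y'⟫
            - ⟪q, x' - y'⟫ - δ * ψ x' - δ * ψ y' ≤
          u (x, t) - v (y, s) - (t - s) ^ 2 / ε - χ s - β / 2 * ⟪A (x - y), x - y⟫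
            - ⟪q, x - y⟫ - δ * ψ x - δ * ψ y := by
    intro x' hx' hx'r y' hy' hy'r t' ht' s' hs'
    have h1 : (x', y', t', s') ∈ S := ⟨⟨hx', hx'r⟩, ⟨hy', hy'r⟩, ht', hs'⟩
    have h2 := hmax h1
    simp only [F, mem_ofPred_eq] at h2
    linarith
  have hval : M₀ ≤ u (x, t) - v (y, s) - (t - s) ^ 2 / ε - χ s - β / 2 * ⟪A (x - y), x - y⟫
      - ⟪q, x - y⟫ - δ * ψ x - δ * ψ y := by
    have h1 := hmax' x₀ hx₀ (by simpa using hr.le) x₀ hx₀ (by simpa using hr.le) t₀ ht₀ s₀ hs₀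
    simp only [sub_self, map_zero, inner_zero_right, hψ₀, mul_zero, sub_zero] at h1
    exact h1
  have hz : (x, y, t, s) ∈ S := ⟨hx, hy, ht, hs⟩
  have hxy : ‖x - y‖ < d' := by
    by_contra! hle
    have h1 := hCmax _ hz
    simp only [F] at h1
    have h2 := mul_le_mul_of_nonneg_left (hpos (x - y)) (half_pos hβ0).le
    have h3 : β / 2 * (l * d' ^ 2) ≤ β / 2 * (l * ‖x - y‖ ^ 2) := by gcongr
    linarith
  have hlat' : ¬(‖x - x₀‖ = r ∨ ‖y - x₀‖ = r) := fun hor => by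
    have h1 := hlat _ ⟨hz, hor⟩ (hxy.trans_le (min_le_left _ _))
    simp only [F] at h1
    have h2 := mul_nonneg (half_pos hβ0).le ((by positivity : 0 ≤ l * ‖x - y‖ ^ 2).trans
      (hpos (x - y)))
    linarith
  push Not at hlat'
  exact ⟨β, hβ0, x, hx.1, y, hy.1, t, ht, s, hs, lt_of_le_of_ne hx.2 hlat'.1,
    lt_of_le_of_ne hy.2 hlat'.2, hxy.trans_le (min_le_right _ _), hval, hmax'⟩

end Doubling

lemma abs_sub_le_of_norm_gradient_le {N : ℕ} {ψ : Euc N → ℝ} {D : Euc N → Euc N} {s : Set (Euc N)}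
    {C : ℝ} (hs : Convex ℝ s) (hψ : ∀ x ∈ s, HasGradientAt ψ (D x) x) (hD : ∀ x ∈ s, ‖D x‖ ≤ C)
    {x y : Euc N} (hx : x ∈ s) (hy : y ∈ s) : |ψ x - ψ y| ≤ C * ‖x - y‖ := by
  have := hs.norm_image_sub_le_of_norm_hasFDerivWithin_le (𝕜 := ℝ)
    (fun z hz => (hψ z hz).hasFDerivAt.hasFDerivWithinAt)
    (fun z hz => by rw [LinearIsometryEquiv.norm_map]; exact hD z hz) hy hx
  rwa [Real.norm_eq_abs] at this

lemma time_localisation {ε τ C a T χs s t w : ℝ} (hε : 0 < ε) (hτ : 0 < τ) (hτ1 : τ ≤ 1)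
    (hεC : ε * C ≤ (τ / 10) ^ 2) (ha : 0 < a) (hχ : 0 ≤ χs) (hχT : s = T → C < χs)
    (hsT : s ≤ T) {d : ℝ} (hd : d < τ / 4)
    (hgap : d + t + s < τ → w < a) (hwC : w ≤ C) (hw : a ≤ w - (t - s) ^ 2 / ε - χs) :
    τ / 4 ≤ s ∧ s < T ∧ 0 < t ∧ t < T + 1 := by
  have hq : 0 ≤ (t - s) ^ 2 / ε := by positivity
  have h1 : (t - s) ^ 2 / ε ≤ C := by linarith
  rw [div_le_iff₀ hε] at h1
  have h2 : |t - s| ≤ τ / 10 := abs_le_of_sq_le_sq (by linarith) (by positivity)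
  obtain ⟨h3, h4⟩ := abs_le.1 h2
  have h5 : τ / 4 ≤ s := by
    by_contra! h
    linarith [hgap (by linarith)]
  refine ⟨h5, lt_of_le_of_ne hsT fun h => ?_, by linarith, by linarith⟩
  linarith [hχT h]

lemma exists_modulus {N : ℕ} {K : Set (Euc N)} (hK : IsCompact K) {H : Euc N → Euc N → ℝ}
    (hH : ContinuousOn (fun q : Euc N × Euc N => H q.1 q.2) (K ×ˢ univ)) (R : ℝ) {c : ℝ}
    (hc : 0 < c) : ∃ d > 0, ∀ x ∈ K, ∀ y ∈ K, ∀ p p', ‖p‖ ≤ R → ‖p'‖ ≤ R → ‖x - y‖ < d →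
      ‖p - p'‖ < d → H y p' - H x p < c := by
  have h1 := (hK.prod (isCompact_closedBall (0 : Euc N) R)).uniformContinuousOn_of_continuous
    (hH.mono (prod_mono_right (subset_univ _)))
  obtain ⟨d, hd, h⟩ := Metric.uniformContinuousOn_iff.1 h1 c hc
  refine ⟨d, hd, fun x hx y hy p p' hp hp' hxy hpp => ?_⟩
  have h2 := h (x, p) ⟨hx, by simpa using hp⟩ (y, p') ⟨hy, by simpa using hp'⟩ (by
    rw [Prod.dist_eq, dist_eq_norm, dist_eq_norm]; exact max_lt hxy hpp)
  rw [Real.dist_eq, abs_sub_comm] at h2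
  exact (abs_lt.1 h2).2

lemma IsCNSub.not_lt_of_gap {N : ℕ} {Ω : Set (Euc N)} {H : Euc N → Euc N → ℝ}
    {γ n : Euc N → Euc N} {g : Euc N → ℝ} {u v : Euc N × ℝ → ℝ}
    (hΩ : IsOpen Ω) (hK : IsCompact (closure Ω)) (hC1 : HasC1Boundary Ω)
    (hH : ContinuousOn (fun q : Euc N × Euc N => H q.1 q.2) (closure Ω ×ˢ (univ : Set (Euc N))))
    (hcoer : Coercive Ω H) (hγ : ContinuousOn γ (closure Ω)) (hg : ContinuousOn g (frontier Ω))
    (hn : ∀ x ∈ frontier Ω, IsOuterUnitNormalAt Ω x (n x))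
    (hobl : ∀ x ∈ frontier Ω, 0 < ⟪γ x, n x⟫)
    (hu : ContinuousOn u (closure Ω ×ˢ Ici 0)) (husub : IsCNSub Ω H γ g u)
    (hvsuper : IsCNSuper Ω H γ g v) {T η C τ ε c₀ : ℝ} {χ χ' : ℝ → ℝ} (hT : 0 < T) (hη : 0 < η)
    (huv : ∀ x ∈ closure Ω, ∀ y ∈ closure Ω, ∀ t ∈ Icc 0 (T + 1), ∀ s ∈ Icc 0 T,
      u (x, t) - v (y, s) ≤ C)
    (huu : ∀ x ∈ closure Ω, ∀ t ∈ Icc 0 (T + 1), ∀ t' ∈ Icc 0 (T + 1), u (x, t) - u (x, t') ≤ C)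
    (hτ : 0 < τ) (hτ1 : τ ≤ 1)
    (hgap : ∀ x ∈ closure Ω, ∀ y ∈ closure Ω, ∀ t ≥ 0, ∀ s ≥ 0, ‖x - y‖ + t + s < τ →
      u (x, t) - v (y, s) < η / 4)
    (hε : 0 < ε) (hεC : ε * C ≤ (τ / 10) ^ 2) (hχc : ContDiff ℝ 1 χ)
    (hχ' : ∀ s, HasDerivAt χ (χ' s) s) (hχ : ∀ s, 0 ≤ χ s) (hχT : C < χ T) (hc₀ : 0 < c₀)
    (hχ'c : ∀ s, 0 ≤ s → c₀ ≤ χ' s) {x₁ : Euc N} {t₁ : ℝ} (hx₁ : x₁ ∈ closure Ω)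
    (ht₁ : t₁ ∈ Icc 0 T) : u (x₁, t₁) - v (x₁, t₁) - χ t₁ < η := by
  by_contra! hbig
  have hv := hvsuper.1
  -- diagonal maximum
  obtain ⟨x₀, hx₀, t₀, ht₀, s₀, hs₀, hM₀, hdiag⟩ : ∃ x₀ ∈ closure Ω, ∃ t₀ ∈ Icc 0 (T + 1),
      ∃ s₀ ∈ Icc 0 T, η ≤ u (x₀, t₀) - v (x₀, s₀) - (t₀ - s₀) ^ 2 / ε - χ s₀ ∧
      ∀ x ∈ closure Ω, ∀ t ∈ Icc 0 (T + 1), ∀ s ∈ Icc 0 T,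
        u (x, t) - v (x, s) - (t - s) ^ 2 / ε - χ s ≤
          u (x₀, t₀) - v (x₀, s₀) - (t₀ - s₀) ^ 2 / ε - χ s₀ := by
    set S : Set (Euc N × Euc N × ℝ × ℝ) :=
      (closure Ω ×ˢ closure Ω ×ˢ Icc 0 (T + 1) ×ˢ Icc 0 T) ∩ {z | z.1 = z.2.1}
    have hS : IsCompact S := (hK.prod (hK.prod (isCompact_Icc.prod isCompact_Icc))).inter_right
      (isClosed_eq (by fun_prop) (by fun_prop))
    have hχcont := hχc.continuous
    have husc := upperSemicontinuousOn_doubled hu hv (S := S)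
      (fun z hz => ⟨hz.1.1, hz.1.2.1, hz.1.2.2.1.1, hz.1.2.2.2.1⟩)
      (F := fun z => (z.2.2.1 - z.2.2.2) ^ 2 / ε + χ z.2.2.2) (by fun_prop)
    have hz₁ : (x₁, x₁, t₁, t₁) ∈ S :=
      ⟨⟨hx₁, hx₁, ⟨ht₁.1, by linarith [ht₁.2]⟩, ht₁⟩, rfl⟩
    obtain ⟨⟨x₀, y₀, t₀, s₀⟩, ⟨⟨hx₀, -, ht₀, hs₀⟩, hxy₀⟩, hmax⟩ := husc.exists_isMaxOn ⟨_, hz₁⟩ hS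
    have hxy₀ : x₀ = y₀ := hxy₀
    subst hxy₀
    have hmax' : ∀ x ∈ closure Ω, ∀ t ∈ Icc 0 (T + 1), ∀ s ∈ Icc 0 T,
        u (x, t) - v (x, s) - (t - s) ^ 2 / ε - χ s ≤
          u (x₀, t₀) - v (x₀, s₀) - (t₀ - s₀) ^ 2 / ε - χ s₀ := fun x hx t ht s hs => by
      have h1 : (x, x, t, s) ∈ S := ⟨⟨hx, hx, ht, hs⟩, rfl⟩
      have h2 := hmax h1
      simp only [mem_ofPred_eq] at h2
      linarith
    refine ⟨x₀, hx₀, t₀, ht₀, s₀, hs₀, ?_, hmax'⟩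
    have h1 := hmax' x₁ hx₁ t₁ ⟨ht₁.1, by linarith [ht₁.2]⟩ t₁ ht₁
    rw [sub_self, zero_pow two_ne_zero, zero_div] at h1
    linarith
  -- Lipschitz regularity of the sup-convolution near the maximum point
  obtain ⟨r₀, hr₀, L, hL, hlip⟩ := exists_lipschitz_timeSup hΩ hK hC1 hcoer hu husub.2.1
    (T := T + 1) (ε := ε) (a := τ / 4) (b := T) (by linarith) hε (by linarith) (by
      intro s hs x hx t ht hst
      have hs' : s ∈ Icc 0 (T + 1) := ⟨by linarith [hs.1], by linarith [hs.2]⟩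
      have h1 := le_timeSup (T := T + 1) (ε := ε) (s := s) hu (subset_closure hx) hs'
      rw [hst, sub_self, zero_pow two_ne_zero, zero_div] at h1
      have h2 := huu x (subset_closure hx) t ht s hs'
      have h3 : (t - s) ^ 2 / ε ≤ C := by linarith
      rw [div_le_iff₀ hε] at h3
      obtain ⟨h4, h5⟩ := abs_le.1 (abs_le_of_sq_le_sq (by linarith) (by positivity) :
        |t - s| ≤ τ / 10)
      exact ⟨by linarith [hs.1], by linarith [hs.2]⟩) hx₀
  obtain ⟨A, m, q, l, hA, hl, hpos, hloc⟩ := exists_local_data hΩ hC1 hγ hg hn hobl hx₀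
  set Cψ : ℝ := ‖m‖ + 2 * (‖m‖ + 1) / l * ‖A‖ with hCψ
  have hCψ0 : 0 ≤ Cψ := by positivity
  set P : ℝ := 2 * (L + ‖q‖ + Cψ) / l with hP
  have hP0 : 0 ≤ P := by positivity
  obtain ⟨δ₁, hδ₁, hmod⟩ := exists_modulus hK hH (‖A‖ * P + ‖q‖ + Cψ) hc₀
  set δ : ℝ := min 1 (δ₁ / (2 * Cψ + 2)) with hδ
  have hδ0 : 0 < δ := by positivity
  have hδ1 : δ ≤ 1 := min_le_left _ _
  have hδδ₁ : 2 * δ * Cψ < δ₁ := by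
    have h1 : δ * (2 * Cψ + 2) ≤ δ₁ := by
      rw [← le_div_iff₀ (by positivity)]; exact min_le_right _ _
    linarith
  obtain ⟨r, hr, hrρ, hbdry⟩ := hloc P hP0 δ hδ0 (min r₀ (η / (8 * (Cψ + 1)))) (by positivity)
  have hrr₀ : r < r₀ := hrρ.trans_le (min_le_left _ _)
  have hrη : Cψ * r ≤ η / 8 := by
    have h1 := (hrρ.trans_le (min_le_right _ _)).le
    rw [le_div_iff₀ (by positivity)] at h1
    linarith
  obtain ⟨ψ, hψc, hψD, hψ₀, hψr⟩ := exists_barrier hA hl hpos m x₀ hr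
  set D : Euc N → Euc N := fun x => m + (2 * (‖m‖ + 1) / (l * r)) • A (x - x₀) with hD
  have hDb : ∀ x, ‖x - x₀‖ ≤ r → ‖D x‖ ≤ Cψ := by
    intro x hx
    refine (norm_add_le _ _).trans (add_le_add_right ?_ _)
    rw [norm_smul, Real.norm_of_nonneg (by positivity)]
    have h1 : ‖A (x - x₀)‖ ≤ ‖A‖ * r := (A.le_opNorm _).trans (by gcongr)
    calc 2 * (‖m‖ + 1) / (l * r) * ‖A (x - x₀)‖
        ≤ 2 * (‖m‖ + 1) / (l * r) * (‖A‖ * r) := by gcongr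
      _ = 2 * (‖m‖ + 1) / l * ‖A‖ := by field_simp
  have hψlip : ∀ x, ‖x - x₀‖ ≤ r → ∀ y, ‖y - x₀‖ ≤ r → |ψ x - ψ y| ≤ Cψ * ‖x - y‖ := by
    intro x hx y hy
    exact abs_sub_le_of_norm_gradient_le (convex_closedBall x₀ r) (fun z _ => hψD z)
      (fun z hz => hDb z (by simpa [dist_eq_norm] using hz)) (by simpa [dist_eq_norm] using hx)
      (by simpa [dist_eq_norm] using hy)
  have hψb : ∀ x, ‖x - x₀‖ ≤ r → |δ * ψ x| ≤ η / 8 := by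
    intro x hx
    have h1 := hψlip x hx x₀ (by simpa using hr.le)
    rw [hψ₀, sub_zero] at h1
    rw [abs_mul, abs_of_pos hδ0]
    have h2 := mul_le_mul_of_nonneg_left hx hCψ0
    have h3 := mul_le_mul_of_nonneg_right hδ1 (abs_nonneg (ψ x))
    linarith
  obtain ⟨β, hβ, x, hx, y, hy, t, ht, s, hs, hxr, hyr, hxy, hval, hmax⟩ :=
    exists_penalised_max hK hu hv hχc.continuous hx₀ ht₀ hs₀ hdiag hl hpos q hψc.continuous hψ₀ hr
      hψr hδ0 (d := min (min δ₁ (τ / 4)) (η / (4 * (‖q‖ + 1)))) (by positivity)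
  have hxyδ : ‖x - y‖ < δ₁ := hxy.trans_le ((min_le_left _ _).trans (min_le_left _ _))
  have hxyτ : ‖x - y‖ < τ / 4 := hxy.trans_le ((min_le_left _ _).trans (min_le_right _ _))
  have hxyq : ‖q‖ * ‖x - y‖ ≤ η / 4 := by
    have h1 := (hxy.trans_le (min_le_right _ _)).le
    rw [le_div_iff₀ (by positivity)] at h1
    linarith [norm_nonneg (x - y)]
  have hqxy := (abs_le.1 (abs_real_inner_le_norm q (x - y)))
  have hquad : β / 2 * (l * ‖x - y‖ ^ 2) ≤ β / 2 * ⟪A (x - y), x - y⟫ :=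
    mul_le_mul_of_nonneg_left (hpos _) (by positivity)
  have hquad0 : 0 ≤ β / 2 * (l * ‖x - y‖ ^ 2) := by positivity
  have hψx := abs_le.1 (hψb x hxr.le)
  have hψy := abs_le.1 (hψb y hyr.le)
  obtain ⟨hsτ, hsT, ht0, htT⟩ := time_localisation hε hτ hτ1 hεC (by positivity : 0 < η / 4) (hχ s)
    (fun h => by rw [h]; exact hχT) hs.2 hxyτ (fun h => hgap x hx y hy t ht.1 s hs.1 h) (huv x hx y hy t ht s hs)
    (by linarith)
  -- the penalisation gradient is bounded
  have hβP : β * ‖x - y‖ ≤ P := by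
    obtain ⟨t', ht', htS⟩ := exists_timeSup_eq (T := T + 1) (ε := ε) (s := s) hu (by linarith) hy
    have h1 := hmax y hy hyr.le y hy hyr.le t' ht' s hs
    rw [sub_self, map_zero, inner_zero_left, inner_zero_right] at h1
    have h2 := le_timeSup (T := T + 1) (ε := ε) (s := s) hu hx ht
    have h3 := hlip s ⟨hsτ, hsT.le⟩ x hx (by rw [mem_ball, dist_eq_norm]; linarith) y hy
      (by rw [mem_ball, dist_eq_norm]; linarith)
    have h4 : δ * (ψ y - ψ x) ≤ Cψ * ‖x - y‖ := by
      have h5 := hψlip y hyr.le x hxr.le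
      rw [norm_sub_rev] at h5
      have h6 := mul_le_mul_of_nonneg_left (le_abs_self (ψ y - ψ x)) hδ0.le
      have h7 := mul_le_mul_of_nonneg_right hδ1 (abs_nonneg (ψ y - ψ x))
      linarith
    rcases (norm_nonneg (x - y)).eq_or_lt with h0 | h0
    · rw [← h0, mul_zero]; exact hP0
    · rw [hP, le_div_iff₀ hl]
      refine le_of_mul_le_mul_right ?_ h0
      linarith
  have hnorm : ∀ z, ‖z‖ ≤ Cψ → ‖β • A (x - y) + q + z‖ ≤ ‖A‖ * P + ‖q‖ + Cψ := by
    intro z hz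
    have h1 : ‖β • A (x - y)‖ ≤ ‖A‖ * P := by
      rw [norm_smul, Real.norm_of_nonneg hβ.le]
      have h2 := mul_le_mul_of_nonneg_left (A.le_opNorm (x - y)) hβ.le
      have h3 := mul_le_mul_of_nonneg_left hβP (norm_nonneg A)
      linarith
    exact (norm_add₃_le).trans (by linarith)
  have hδD : ∀ x, ‖x - x₀‖ ≤ r → ‖δ • D x‖ ≤ Cψ := by
    intro x hx
    rw [norm_smul, Real.norm_of_nonneg hδ0.le]
    have := mul_le_mul hδ1 (hDb x hx) (norm_nonneg _) zero_le_one
    linarith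
  have hsubineq := husub.le_of_penalised_max hΩ hA hψc (hψD x) (β := β) (δ := δ) (ε := ε) (q := q)
    (s := s) (y := y) hx hxr ht0 htT
    (fun x' hx' hx'r t' ht' => by
      have h1 := hmax x' hx' hx'r y hy hyr.le t' ht' s hs
      rw [inner_sub_right q, inner_sub_right q] at h1
      linarith)
    (fun hxb => by
      have h1 := hbdry x hxb hxr.le y hy hyr.le β hβ.le hβP
      have h2 := (abs_lt.1 h1).1
      rw [inner_add_right, inner_add_right, real_inner_smul_right, real_inner_smul_right]
      linarith)
  have hsupineq := hvsuper.ge_of_penalised_max hΩ hA hψc hχc (hψD y) (β := β) (δ := δ) (ε := ε)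
    (q := q) (t := t) (x := x) (hχ' s) hy hyr (by linarith) hsT
    (fun y' hy' hy'r s' hs' => by
      have h1 := hmax x hx hxr.le y' hy' hy'r t ht s' hs'
      rw [inner_sub_right q, inner_sub_right q] at h1
      linarith)
    (fun hyb => by
      have h1 := hbdry y hyb hyr.le x hx hxr.le β hβ.le (by rwa [norm_sub_rev])
      have h2 := (abs_lt.1 h1).2
      rw [← neg_sub x y, map_neg, inner_neg_right] at h2
      rw [inner_sub_right, inner_add_right, real_inner_smul_right, real_inner_smul_right]
      linarith)
  have hfin := hmod x hx y hy _ (β • A (x - y) + q - δ • D y) (hnorm _ (hδD x hxr.le)) (by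
    rw [sub_eq_add_neg]; exact hnorm _ (by rw [norm_neg]; exact hδD y hyr.le)) hxyδ (by
    have h1 : β • A (x - y) + q + δ • D x - (β • A (x - y) + q - δ • D y) = δ • (D x + D y) := by
      module
    rw [h1, norm_smul, Real.norm_of_nonneg hδ0.le]
    have h2 := (norm_add_le (D x) (D y)).trans (add_le_add (hDb x hxr.le) (hDb y hyr.le))
    have h3 := mul_le_mul_of_nonneg_left h2 hδ0.le
    linarith)
  linarith [hχ'c s hs.1]

/-- comparison principle for the Cauchy–Neumann problem (CN). -/
theorem statement18
    (N : ℕ) (Ω : Set (Euc N)) (H : Euc N → Euc N → ℝ)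
    (γ n : Euc N → Euc N) (g : Euc N → ℝ) (u₀ : Euc N → ℝ)
    (hΩopen : IsOpen Ω) (hΩconn : IsConnected Ω) (hΩbdd : Bornology.IsBounded Ω)
    (hΩC1 : HasC1Boundary Ω)
    (hHcont : ContinuousOn (fun q : Euc N × Euc N => H q.1 q.2)
      (closure Ω ×ˢ (univ : Set (Euc N))))
    (hcoer : Coercive Ω H)
    (hu₀ : ∃ K : NNReal, LipschitzOnWith K u₀ (closure Ω))
    (hγ : ContinuousOn γ (closure Ω)) (hg : ContinuousOn g (frontier Ω))
    (hn : ∀ x ∈ frontier Ω, IsOuterUnitNormalAt Ω x (n x))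
    (hobl : ∀ x ∈ frontier Ω, 0 < ⟪γ x, n x⟫)
    (u v : Euc N × ℝ → ℝ)
    (hucont : ContinuousOn u (closure Ω ×ˢ Ici (0:ℝ)))
    (husub : IsCNSub Ω H γ g u)
    (hvsuper : IsCNSuper Ω H γ g v)
    (hinit : ∀ x ∈ closure Ω, u (x, 0) ≤ v (x, 0)) :
    ∀ x ∈ closure Ω, ∀ t : ℝ, 0 ≤ t → u (x, t) ≤ v (x, t) := by
  have hK : IsCompact (closure Ω) := hΩbdd.isCompact_closure
  intro x₁ hx₁ t₁ ht₁
  by_contra! hlt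
  set η : ℝ := (u (x₁, t₁) - v (x₁, t₁)) / 2 with hη
  have hη0 : 0 < η := by linarith
  set T : ℝ := t₁ + 1 with hT
  have hT0 : 0 < T := by linarith
  obtain ⟨τ, hτ, hτ1, hgap⟩ :=
    exists_initial_gap hK hucont hvsuper.1 hinit (by positivity : 0 < η / 4)
  obtain ⟨C, hC, huv, huu⟩ : ∃ C > 0, (∀ x ∈ closure Ω, ∀ y ∈ closure Ω, ∀ t ∈ Icc 0 (T + 1),
      ∀ s ∈ Icc 0 T, u (x, t) - v (y, s) ≤ C) ∧
      ∀ x ∈ closure Ω, ∀ t ∈ Icc 0 (T + 1), ∀ t' ∈ Icc 0 (T + 1),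
        u (x, t) - u (x, t') ≤ C := by
    have husc := upperSemicontinuousOn_doubled hucont hvsuper.1
      (S := closure Ω ×ˢ closure Ω ×ˢ Icc 0 (T + 1) ×ˢ Icc 0 T)
      (fun z hz => ⟨hz.1, hz.2.1, hz.2.2.1.1, hz.2.2.2.1⟩) (F := fun _ => 0) continuousOn_const
    have hz₀ : (x₁, x₁, (0 : ℝ), (0 : ℝ)) ∈
        closure Ω ×ˢ closure Ω ×ˢ Icc 0 (T + 1) ×ˢ Icc 0 T :=
      ⟨hx₁, hx₁, ⟨le_rfl, by linarith⟩, le_rfl, hT0.le⟩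
    obtain ⟨z, -, hz⟩ := husc.exists_isMaxOn ⟨_, hz₀⟩
      (hK.prod (hK.prod (isCompact_Icc.prod isCompact_Icc)))
    have hKT : IsCompact (closure Ω ×ˢ Icc (0 : ℝ) (T + 1)) := hK.prod isCompact_Icc
    obtain ⟨B, hB⟩ := hKT.exists_bound_of_continuousOn
      (hucont.mono (prod_mono Subset.rfl Icc_subset_Ici_self))
    set a := u (z.1, z.2.2.1) - 0 - v (z.2.1, z.2.2.2) with ha
    refine ⟨max (max a (2 * B)) 1, lt_max_of_lt_right one_pos, fun x hx y hy t ht s hs => ?_,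
      fun x hx t ht t' ht' => ?_⟩
    · have h1 : (x, y, t, s) ∈ closure Ω ×ˢ closure Ω ×ˢ Icc 0 (T + 1) ×ˢ Icc 0 T :=
        ⟨hx, hy, ht, hs⟩
      have h2 : u (x, t) - 0 - v (y, s) ≤ a := hz h1
      linarith [le_max_left (max a (2 * B)) 1, le_max_left a (2 * B)]
    · have h1 := (abs_le.1 (hB (x, t) ⟨hx, ht⟩)).2
      have h2 := (abs_le.1 (hB (x, t') ⟨hx, ht'⟩)).1
      linarith [le_max_left (max a (2 * B)) 1, le_max_right a (2 * B)]
  set k : ℝ := C / η with hk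
  have hk0 : 0 < k := by positivity
  have hχ' : ∀ s, HasDerivAt (fun s => η * Real.exp (k * (s - t₁)))
      (k * (η * Real.exp (k * (s - t₁)))) s := fun s => by
    refine ((((((hasDerivAt_id s).sub_const t₁).const_mul k).exp).const_mul η)).congr_deriv ?_
    simp only [id_eq]
    ring
  have := husub.not_lt_of_gap hΩopen hK hΩC1 hHcont hcoer hγ hg hn hobl hucont hvsuper hT0 hη0
    huv huu hτ hτ1 hgap (ε := (τ / 10) ^ 2 / C) (by positivity)
    (by rw [div_mul_cancel₀ _ hC.ne']) (by fun_prop) hχ' (fun s => by positivity) (by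
      have h1 := mul_le_mul_of_nonneg_left (Real.add_one_le_exp k) hη0.le
      have h2 : η * (k + 1) = C + η := by rw [hk]; field_simp
      have h3 : k * (T - t₁) = k := by rw [hT]; ring
      rw [h3]
      linarith)
    (c₀ := k * (η * Real.exp (k * (0 - t₁)))) (by positivity) (fun s hs => by gcongr) hx₁
    (⟨ht₁, by linarith⟩ : t₁ ∈ Icc 0 T)
  rw [sub_self, mul_zero, Real.exp_zero] at this
  linarith
end
end

section
/- Assume Ω ⊂ ℝ^N is a bounded domain with a C⁰ boundary and H is continuous and coercive ((A1)). Let u ∈ C(cl(Ω)×[0,∞)) be a subsolution and v a lower semicontinuous supersolution of the state-constraint problem (SC), or of the Cauchy–Dirichlet problem (CD) with continuous boundary datum g. If u(·,0) ≤ v(·,0) on cl(Ω), then u ≤ v on cl(Ω)×[0,∞). -/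
open Set Metric Filter
open scoped RealInnerProductSpace Topology

noncomputable section

lemma timeDeriv_add_separated {N : ℕ} {f : Euc N → ℝ} {h : ℝ → ℝ} {x p : Euc N} {t q : ℝ}
    (hf : HasGradientAt f p x) (hh : HasDerivAt h q t) :
    timeDeriv (fun z : Euc N × ℝ => f z.1 + h z.2) (x, t) = q := by
  have h1 : HasFDerivAt (fun z : Euc N × ℝ => f z.1)
      ((InnerProductSpace.toDual ℝ (Euc N) p).comp (ContinuousLinearMap.fst ℝ (Euc N) ℝ)) (x, t) :=
    HasFDerivAt.comp (x, t) (g := f) hf.hasFDerivAt hasFDerivAt_fst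
  have h2 : HasFDerivAt (fun z : Euc N × ℝ => h z.2)
      ((ContinuousLinearMap.toSpanSingleton ℝ q).comp (ContinuousLinearMap.snd ℝ (Euc N) ℝ))
      (x, t) :=
    HasFDerivAt.comp (x, t) (g := h) hh.hasFDerivAt hasFDerivAt_snd
  have h3 : HasFDerivAt (fun z : Euc N × ℝ => f z.1 + h z.2) _ (x, t) := h1.add h2
  rw [timeDeriv, h3.fderiv]
  simp

lemma spaceGrad_add_separated {N : ℕ} {f : Euc N → ℝ} {x p : Euc N} (hf : HasGradientAt f p x)
    (h : ℝ → ℝ) (t : ℝ) :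
    spaceGrad (fun z : Euc N × ℝ => f z.1 + h z.2) (x, t) = p := by
  have : HasGradientAt (fun y => f y + h t) p x :=
    hasGradientAt_iff_hasFDerivAt.2 (hf.hasFDerivAt.add_const (h t))
  exact this.gradient

lemma hasGradientAt_norm_sub_sq_add {N : ℕ} (A B : ℝ) (c z x : Euc N) :
    HasGradientAt (fun y => A * ‖y - c‖ ^ 2 + B * ‖y - z‖ ^ 2)
      ((2 * A) • (x - c) + (2 * B) • (x - z)) x := by
  rw [hasGradientAt_iff_hasFDerivAt]
  have h (c : Euc N) := ((hasFDerivAt_id (𝕜 := ℝ) x).sub_const c).norm_sq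
  refine (((h c).const_mul A).add ((h z).const_mul B)).congr_fderiv ?_
  ext y
  simp
  ring

lemma contDiff_norm_sub_sq_add {N : ℕ} (A B : ℝ) (c z : Euc N) :
    ContDiff ℝ 1 (fun y : Euc N => A * ‖y - c‖ ^ 2 + B * ‖y - z‖ ^ 2) :=
  (contDiff_const.mul ((contDiff_id.sub contDiff_const).norm_sq ℝ)).add
    (contDiff_const.mul ((contDiff_id.sub contDiff_const).norm_sq ℝ))

lemma LowerSemicontinuousOn.le_of_tendsto {X ι : Type*} [TopologicalSpace X] {S : Set X}
    {v : X → ℝ} (hv : LowerSemicontinuousOn v S) {l : Filter ι} [l.NeBot] {p : ι → X} {p₀ : X}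
    (hp : Tendsto p l (𝓝 p₀)) (hpS : ∀ i, p i ∈ S) (hp₀ : p₀ ∈ S) {c : ι → ℝ} {c₀ : ℝ}
    (hc : Tendsto c l (𝓝 c₀)) (hle : ∀ᶠ i in l, v (p i) ≤ c i) : v p₀ ≤ c₀ := by
  by_contra! hlt
  obtain ⟨m, hm₁, hm₂⟩ := exists_between hlt
  have h1 : ∀ᶠ i in l, m < v (p i) :=
    (tendsto_nhdsWithin_iff.2 ⟨hp, Eventually.of_forall hpS⟩).eventually (hv p₀ hp₀ m hm₂)
  obtain ⟨i, h1, h2, h3⟩ := (h1.and (hle.and (hc.eventually_lt_const hm₁))).exists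
  linarith

lemma IsCompact.exists_tendsto_hyperfilter {X : Type*} [TopologicalSpace X] {K : Set X}
    (hK : IsCompact K) {p : ℕ → X} (hp : ∀ᶠ n in (hyperfilter ℕ : Filter ℕ), p n ∈ K) :
    ∃ a ∈ K, Tendsto p (hyperfilter ℕ : Filter ℕ) (𝓝 a) := by
  obtain ⟨a, ha, hle⟩ := hK.ultrafilter_le_nhds ((hyperfilter ℕ).map p)
    (by rw [Ultrafilter.coe_map, le_principal_iff]; exact hp)
  exact ⟨a, ha, hle⟩

lemma exists_max_sub_sub {X : Type*} [TopologicalSpace X] {S : Set X} {u v : X → ℝ}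
    (hu : ContinuousOn u S) (hv : LowerSemicontinuousOn v S) {K : Set (X × X)} (hK : IsCompact K)
    (hne : K.Nonempty) (hKS : K ⊆ S ×ˢ S) {c : X × X → ℝ} (hc : ContinuousOn c K) :
    ∃ q ∈ K, ∀ q' ∈ K, u q'.1 - v q'.2 - c q' ≤ u q.1 - v q.2 - c q := by
  have h1 : LowerSemicontinuousOn (fun q : X × X => v q.2) K :=
    hv.comp continuous_snd.continuousOn fun q hq => (hKS hq).2
  have h2 : ContinuousOn (fun q : X × X => c q - u q.1) K :=
    hc.sub (hu.comp continuous_fst.continuousOn fun q hq => (hKS hq).1)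
  obtain ⟨q, hq, hmin⟩ := (h1.add h2.lowerSemicontinuousOn).exists_isMinOn hne hK
  refine ⟨q, hq, fun q' hq' => ?_⟩
  have := hmin hq'
  simp only [mem_ofPred_eq] at this
  linarith

lemma HasC0Boundary.exists_inward_shift {N : ℕ} {Ω : Set (Euc N)} (hΩ : IsOpen Ω)
    (hC0 : HasC0Boundary Ω) {z : Euc N} (hz : z ∈ closure Ω) :
    ∃ (ν : Euc N) (r : ℝ), 0 < r ∧ ∀ y ∈ closure Ω, dist y z ≤ r →
      ∀ a : ℝ, 0 < a → a < r → y + a • ν ∈ Ω := by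
  by_cases hzΩ : z ∈ Ω
  · obtain ⟨r, hr, hball⟩ := Metric.isOpen_iff.1 hΩ z hzΩ
    refine ⟨0, r / 2, by linarith, fun y _ hyz a _ _ => ?_⟩
    rw [smul_zero, add_zero]
    exact hball (mem_ball.2 (by linarith))
  · obtain ⟨ν, r, b, hν, hr, hb, heq⟩ := hC0 z ⟨hz, by rwa [hΩ.interior_eq]⟩
    refine ⟨ν, r / 2, by linarith, fun y hy hyz a ha har => ?_⟩
    have hyb : b (y - ⟪y, ν⟫ • ν) ≤ ⟪y, ν⟫ := by
      have hmem : y ∈ closure (Ω ∩ ball z r) := by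
        rw [inter_comm]
        exact isOpen_ball.inter_closure ⟨mem_ball.2 (by linarith), hy⟩
      have hcl : IsClosed {x : Euc N | b (x - ⟪x, ν⟫ • ν) ≤ ⟪x, ν⟫} :=
        isClosed_le (by fun_prop) (by fun_prop)
      refine closure_minimal (fun x hx => ?_) hcl hmem
      rw [heq] at hx
      exact hx.2.le
    have hin : ⟪y + a • ν, ν⟫ = ⟪y, ν⟫ + a := by
      rw [inner_add_left, real_inner_smul_left, real_inner_self_eq_norm_sq, hν]; ring
    have hproj : y + a • ν - ⟪y + a • ν, ν⟫ • ν = y - ⟪y, ν⟫ • ν := by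
      rw [hin, add_smul]; abel
    have : y + a • ν ∈ Ω ∩ ball z r := by
      rw [heq]
      refine ⟨?_, ?_⟩
      · rw [mem_ball]
        calc dist (y + a • ν) z ≤ dist (y + a • ν) y + dist y z := dist_triangle _ _ _
          _ = a + dist y z := by
            rw [dist_eq_norm, add_sub_cancel_left, norm_smul, hν, Real.norm_of_nonneg ha.le, mul_one]
          _ < r := by linarith
      · rw [hproj, hin]
        linarith
    exact this.1

lemma HasC0Boundary.exists_notMem_closure {N : ℕ} {Ω : Set (Euc N)} (hΩ : IsOpen Ω)
    (hC0 : HasC0Boundary Ω) {z : Euc N} (hz : z ∈ frontier Ω) {ε : ℝ} (hε : 0 < ε) :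
    ∃ y ∉ closure Ω, dist y z < ε := by
  obtain ⟨ν, r, b, hν, hr, hb, heq⟩ := hC0 z hz
  obtain ⟨a, ha, har⟩ := exists_between (lt_min hr hε)
  have hin : ⟪z - a • ν, ν⟫ = ⟪z, ν⟫ - a := by
    rw [inner_sub_left, real_inner_smul_left, real_inner_self_eq_norm_sq, hν]; ring
  have hproj : z - a • ν - ⟪z - a • ν, ν⟫ • ν = z - ⟪z, ν⟫ • ν := by
    rw [hin, sub_smul]; abel
  have hdist : dist (z - a • ν) z = a := by
    rw [dist_eq_norm, sub_sub_cancel_left, norm_neg, norm_smul, hν, Real.norm_of_nonneg ha.le,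
      mul_one]
  have hzb : ⟪z, ν⟫ ≤ b (z - ⟪z, ν⟫ • ν) := by
    by_contra! hlt
    have : z ∈ Ω ∩ ball z r := by
      rw [heq]
      exact ⟨mem_ball_self hr, hlt⟩
    rw [hΩ.frontier_eq] at hz
    exact hz.2 this.1
  refine ⟨z - a • ν, fun hcl => ?_, by rw [hdist]; exact har.trans_le (min_le_right _ _)⟩
  have hopen : IsOpen {x : Euc N | ⟪x, ν⟫ < b (x - ⟪x, ν⟫ • ν)} :=
    isOpen_lt (by fun_prop) (by fun_prop)
  obtain ⟨x, ⟨hx₁, hx₂⟩, hx₃⟩ := mem_closure_iff.1 hcl _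
    (hopen.inter (isOpen_ball : IsOpen (ball z r)))
    ⟨by rw [mem_ofPred_eq, hproj, hin]; linarith,
      by rw [mem_ball, hdist]; exact har.trans_le (min_le_left _ _)⟩
  have : x ∈ Ω ∩ ball z r := ⟨hx₃, hx₂⟩
  rw [heq] at this
  exact lt_asymm hx₁ this.2

lemma IsCDSub.le_boundary_datum {N : ℕ} {Ω : Set (Euc N)} {H : Euc N → Euc N → ℝ} {g : Euc N → ℝ}
    {u : Euc N × ℝ → ℝ} (hΩ : IsOpen Ω) (hK : IsCompact (closure Ω)) (hC0 : HasC0Boundary Ω)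
    (hcoer : Coercive Ω H) (hu : ContinuousOn u (closure Ω ×ˢ Ici (0:ℝ)))
    (hg : ContinuousOn g (frontier Ω)) (hsub : IsCDSub Ω H g u) {x₀ : Euc N}
    (hx₀ : x₀ ∈ frontier Ω) {t₀ : ℝ} (ht₀ : 0 < t₀) : u (x₀, t₀) ≤ g x₀ := by
  by_contra! hlt
  obtain ⟨m, hm₁, hm₂⟩ := exists_between hlt
  have hx₀' : x₀ ∈ closure Ω := frontier_subset_closure hx₀
  obtain ⟨ρ₁, hρ₁, hg'⟩ := Metric.mem_nhdsWithin_iff.1 ((hg x₀ hx₀).eventually_lt_const hm₁)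
  obtain ⟨ρ₂, hρ₂, hu'⟩ := Metric.mem_nhdsWithin_iff.1
    ((hu (x₀, t₀) ⟨hx₀', ht₀.le⟩).eventually_const_lt hm₂)
  obtain ⟨ρ, hρ, hρ₁', hρ₂'⟩ : ∃ ρ, 0 < ρ ∧ ρ ≤ ρ₁ ∧ ρ ≤ ρ₂ :=
    ⟨min ρ₁ ρ₂, lt_min hρ₁ hρ₂, min_le_left _ _, min_le_right _ _⟩
  obtain ⟨τ, hτ, hτρ, hτt⟩ : ∃ τ, 0 < τ ∧ τ < ρ ∧ τ < t₀ := by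
    obtain ⟨τ, h1, h2⟩ := exists_between (lt_min hρ ht₀)
    exact ⟨τ, h1, h2.trans_le (min_le_left _ _), h2.trans_le (min_le_right _ _)⟩
  have hKc : IsCompact (closure Ω ×ˢ Icc (t₀ - τ) (t₀ + τ)) := hK.prod isCompact_Icc
  have hsubset : closure Ω ×ˢ Icc (t₀ - τ) (t₀ + τ) ⊆ closure Ω ×ˢ Ici (0:ℝ) :=
    prod_mono_right fun t ht => mem_Ici.2 (by linarith [ht.1])
  have huK := hu.mono hsubset
  obtain ⟨B, hB⟩ := hKc.exists_bound_of_continuousOn huK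
  have hmem₀ : (x₀, t₀) ∈ closure Ω ×ˢ Icc (t₀ - τ) (t₀ + τ) :=
    ⟨hx₀', by constructor <;> linarith⟩
  have hB0 : 0 ≤ B := (norm_nonneg _).trans (hB _ hmem₀)
  obtain ⟨A, hA0, hA⟩ : ∃ A : ℝ, 0 ≤ A ∧ 2 * B < A * τ ^ 2 :=
    ⟨(2 * B + 1) / τ ^ 2, by positivity, by rw [div_mul_cancel₀ _ (by positivity)]; linarith⟩
  obtain ⟨x₁, hx₁, hx₁ρ⟩ := hC0.exists_notMem_closure hΩ hx₀ (show 0 < ρ / 3 by linarith)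
  obtain ⟨d, hd, hball⟩ := Metric.isOpen_iff.1 isClosed_closure.isOpen_compl x₁ hx₁
  obtain ⟨R, hR⟩ := hcoer (2 * A * τ + 1)
  obtain ⟨k, hk0, hkR, hkB⟩ : ∃ k : ℝ, 0 < k ∧ R ≤ 2 * k * d ∧ 2 * B ≤ k * (ρ / 3) ^ 2 := by
    refine ⟨|R| / (2 * d) + 2 * B / (ρ / 3) ^ 2 + 1, by positivity, ?_, ?_⟩
    · have h1 : 2 * (|R| / (2 * d)) * d = |R| := by field_simp
      have h2 : 0 ≤ 2 * B / (ρ / 3) ^ 2 := by positivity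
      nlinarith [le_abs_self R, mul_nonneg h2 hd.le]
    · have h1 : 2 * B / (ρ / 3) ^ 2 * (ρ / 3) ^ 2 = 2 * B := div_mul_cancel₀ _ (by positivity)
      have h2 : 0 ≤ |R| / (2 * d) * (ρ / 3) ^ 2 := by positivity
      nlinarith [sq_nonneg (ρ / 3)]
  set φ : Euc N × ℝ → ℝ := fun p =>
    (k * ‖p.1 - x₁‖ ^ 2 + 0 * ‖p.1 - x₁‖ ^ 2) + A * (p.2 - t₀) ^ 2 with hφ
  have hφC : ContDiff ℝ 1 φ := ((contDiff_norm_sub_sq_add k 0 x₁ x₁).comp contDiff_fst).add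
    (contDiff_const.mul ((contDiff_snd.sub contDiff_const).pow 2))
  obtain ⟨⟨x, t⟩, hxt, hmax⟩ := hKc.exists_isMaxOn ⟨_, hmem₀⟩ (huK.sub hφC.continuous.continuousOn)
  obtain ⟨hx, ht⟩ := hxt
  have hux := abs_le.1 (hB (x, t) ⟨hx, ht⟩)
  have hx_near : dist x x₀ < ρ := by
    have h1 := hmax hmem₀
    have h2 := abs_le.1 (hB _ hmem₀)
    simp only [mem_ofPred_eq, hφ, Pi.sub_apply, sub_self] at h1
    have h3 : ‖x₀ - x₁‖ < ρ / 3 := by rwa [← dist_eq_norm, dist_comm]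
    have h4 : 0 ≤ A * (t - t₀) ^ 2 := by positivity
    have h5 : k * ‖x₀ - x₁‖ ^ 2 ≤ k * (ρ / 3) ^ 2 := by gcongr
    have h6 : ‖x - x₁‖ ^ 2 < (2 * (ρ / 3)) ^ 2 := by
      have : k * ‖x - x₁‖ ^ 2 < k * (2 * (ρ / 3)) ^ 2 := by
        have : 0 < k * (ρ / 3) ^ 2 := by positivity
        nlinarith
      exact lt_of_mul_lt_mul_left this hk0.le
    have h7 : ‖x - x₁‖ < 2 * (ρ / 3) := lt_of_pow_lt_pow_left₀ 2 (by positivity) h6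
    calc dist x x₀ ≤ dist x x₁ + dist x₁ x₀ := dist_triangle _ _ _
      _ < ρ := by rw [dist_eq_norm]; linarith
  have ht_near : |t - t₀| < τ := by
    have h1 := hmax (show (x, t₀) ∈ _ from ⟨hx, hmem₀.2⟩)
    have h2 := abs_le.1 (hB (x, t₀) ⟨hx, hmem₀.2⟩)
    simp only [mem_ofPred_eq, hφ, Pi.sub_apply, sub_self] at h1
    by_contra! hle
    have h3 : τ ^ 2 ≤ (t - t₀) ^ 2 := by
      rw [← sq_abs (t - t₀)]; gcongr
    nlinarith [mul_le_mul_of_nonneg_left h3 hA0]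
  have ht_near' := abs_lt.1 ht_near
  have ht0 : 0 < t := by linarith [ht.1]
  have hloc : IsLocalMaxOn (fun p => u p - φ p) (closure Ω ×ˢ Ioi (0:ℝ)) (x, t) := by
    have hnhds : ∀ᶠ p : Euc N × ℝ in 𝓝 (x, t), p.2 ∈ Icc (t₀ - τ) (t₀ + τ) :=
      continuous_snd.continuousAt.eventually
        (Icc_mem_nhds (by simp; linarith) (by simp; linarith))
    filter_upwards [mem_nhdsWithin_of_mem_nhds hnhds, self_mem_nhdsWithin] with p hp hpS
    exact hmax ⟨hpS.1, hp⟩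
  have hgrad := hasGradientAt_norm_sub_sq_add k 0 x₁ x₁ x
  have hder : HasDerivAt (fun s : ℝ => A * (s - t₀) ^ 2) (2 * A * (t - t₀)) t := by
    refine ((((hasDerivAt_id' t).sub_const t₀).fun_pow 2).const_mul A).congr_deriv ?_
    push_cast
    ring
  have heqn : timeDeriv φ (x, t) + H x (spaceGrad φ (x, t)) ≤ 0 := by
    by_cases hxΩ : x ∈ Ω
    · exact hsub.2.1 φ hφC x hxΩ t ht0 (hloc.on_subset (prod_mono_left subset_closure))
    · have hxf : x ∈ frontier Ω := by
        rw [hΩ.frontier_eq]; exact ⟨hx, hxΩ⟩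
      have h1 : g x < m := hg' ⟨hx_near.trans_le hρ₁', hxf⟩
      have h2 : m < u (x, t) := by
        refine hu' (show (x, t) ∈ _ from ⟨?_, hx, ht0.le⟩)
        rw [mem_ball, Prod.dist_eq]
        refine max_lt (hx_near.trans_le hρ₂') ?_
        rw [Real.dist_eq]; linarith
      rcases min_le_iff.1 (hsub.2.2 φ hφC x hxf t ht0 hloc) with h | h
      · exact h
      · linarith
  rw [hφ, timeDeriv_add_separated hgrad hder,
    spaceGrad_add_separated hgrad (fun s => A * (s - t₀) ^ 2), mul_zero, zero_smul,
    add_zero] at heqn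
  have hdist : d ≤ ‖x - x₁‖ := by
    by_contra! hlt
    exact hball (show x ∈ ball x₁ d by rwa [mem_ball, dist_eq_norm]) hx
  have := hR x hx ((2 * k) • (x - x₁)) (by
    rw [norm_smul, Real.norm_of_nonneg (by positivity)]
    exact hkR.trans (by gcongr))
  nlinarith

/-- The doubling of variables with a shifted spatial penalty `‖x - y - a • ν‖²`, where the shift
`a • ν` pushes the points of `closure Ω` near `z` into `Ω`. -/
lemma false_of_doubling {N : ℕ} {Ω : Set (Euc N)} {H : Euc N → Euc N → ℝ} {u v : Euc N × ℝ → ℝ}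
    (hΩ : IsOpen Ω) (hK : IsCompact (closure Ω))
    (hH : ContinuousOn (fun q : Euc N × Euc N => H q.1 q.2) (closure Ω ×ˢ (univ : Set (Euc N))))
    (hcoer : Coercive Ω H) (hu : ContinuousOn u (closure Ω ×ˢ Ici (0:ℝ)))
    (hv : LowerSemicontinuousOn v (closure Ω ×ˢ Ici (0:ℝ))) (hsub : ParSubOn H u Ω)
    (hsuper : ∀ φ : Euc N × ℝ → ℝ, ContDiff ℝ 1 φ → ∀ x ∈ closure Ω, ∀ s : ℝ, 0 < s →
      (∃ t : ℝ, 0 < t ∧ v (x, s) < u (x, t)) →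
      IsLocalMinOn (fun p => v p - φ p) (closure Ω ×ˢ Ioi (0:ℝ)) (x, s) →
      0 ≤ timeDeriv φ (x, s) + H x (spaceGrad φ (x, s)))
    {T₁ T₂ Λ M : ℝ} (hΛ : 0 ≤ Λ) (hM : 0 < M) {χ : ℝ → ℝ} (hχ : ContDiff ℝ 1 χ)
    (hχ_nonneg : ∀ t, 0 ≤ χ t) (hχ_deriv : ∀ t, 0 < deriv χ t)
    {z ν : Euc N} (hz : z ∈ closure Ω) {r : ℝ} (hr : 0 < r)
    (hshift : ∀ y ∈ closure Ω, dist y z ≤ r → ∀ a : ℝ, 0 < a → a < r → y + a • ν ∈ Ω)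
    {τ σ : ℝ} (hτ : τ ∈ Icc 0 T₁) (hσ : σ ∈ Icc 0 T₂)
    (hval : M = u (z, τ) - v (z, σ) - Λ * (τ - σ) ^ 2 - χ τ)
    (hmax : ∀ x ∈ closure Ω, ∀ t ∈ Icc 0 T₁, ∀ s ∈ Icc 0 T₂,
      u (x, t) - v (x, s) - Λ * (t - s) ^ 2 - χ t ≤ M)
    (hinterior : ∀ t ∈ Icc 0 T₁, ∀ s ∈ Icc 0 T₂,
      M ≤ u (z, t) - v (z, s) - Λ * (t - s) ^ 2 - χ t → t ∈ Ioo 0 T₁ ∧ s ∈ Ioo 0 T₂) : False := by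
  have hS₁ : closure Ω ×ˢ Icc 0 T₁ ⊆ closure Ω ×ˢ Ici (0:ℝ) := prod_mono_right Icc_subset_Ici_self
  have hS₂ : closure Ω ×ˢ Icc 0 T₂ ⊆ closure Ω ×ˢ Ici (0:ℝ) := prod_mono_right Icc_subset_Ici_self
  set K : Set ((Euc N × ℝ) × (Euc N × ℝ)) := (closure Ω ×ˢ Icc 0 T₁) ×ˢ (closure Ω ×ˢ Icc 0 T₂)
  have hKc : IsCompact K := (hK.prod isCompact_Icc).prod (hK.prod isCompact_Icc)
  have hKS : K ⊆ (closure Ω ×ˢ Ici (0:ℝ)) ×ˢ (closure Ω ×ˢ Ici (0:ℝ)) := prod_mono hS₁ hS₂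
  have hKne : K.Nonempty := ⟨((z, τ), (z, σ)), ⟨hz, hτ⟩, hz, hσ⟩
  obtain ⟨C, hC0, hC⟩ : ∃ C : ℝ, 0 < C ∧ ∀ q ∈ K, u q.1 - v q.2 ≤ C := by
    obtain ⟨q, -, hq⟩ := exists_max_sub_sub hu hv hKc hKne hKS
      (c := fun _ => 0) continuousOn_const
    refine ⟨|u q.1 - v q.2| + 1, by positivity, fun q' hq' => ?_⟩
    have := hq q' hq'
    linarith [le_abs_self (u q.1 - v q.2)]
  set a : ℕ → ℝ := fun n => r / (n + 2) with ha
  have ha0 (n : ℕ) : 0 < a n := by positivity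
  have har (n : ℕ) : a n < r := by
    rw [ha, div_lt_iff₀ (by positivity)]; nlinarith [(n.cast_nonneg : (0:ℝ) ≤ n)]
  have hatop : Tendsto a (hyperfilter ℕ : Filter ℕ) (𝓝 0) :=
    (tendsto_const_nhds.div_atTop (tendsto_atTop_add_const_right _ _
      tendsto_natCast_atTop_atTop)).mono_left Nat.hyperfilter_le_atTop
  have hpen (n : ℕ) : ∃ A : ℝ, (n + 1 : ℝ) ≤ A ∧ ∀ y ∈ closure Ω, dist y z ≤ r → ∀ w : Euc N,
      A * ‖w - (y + a n • ν)‖ ^ 2 ≤ C → w ∈ Ω := by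
    have hKn : IsCompact ((fun y => y + a n • ν) '' (closure Ω ∩ closedBall z r)) :=
      (hK.inter_right isClosed_closedBall).image (by fun_prop)
    obtain ⟨d, hd, hthick⟩ := hKn.exists_thickening_subset_open hΩ (by
      rintro _ ⟨y, ⟨hy, hyz⟩, rfl⟩
      exact hshift y hy hyz _ (ha0 n) (har n))
    refine ⟨n + 1 + C / d ^ 2, by linarith [show 0 < C / d ^ 2 by positivity],
      fun y hy hyz w hw => hthick (mem_thickening_iff.2 ⟨_, ⟨y, ⟨hy, hyz⟩, rfl⟩, ?_⟩)⟩
    rw [dist_eq_norm]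
    by_contra! hle
    have h1 : d ^ 2 ≤ ‖w - (y + a n • ν)‖ ^ 2 := by gcongr
    have h2 : C / d ^ 2 * d ^ 2 = C := div_mul_cancel₀ _ (by positivity)
    have h3 : (n + 1 + C / d ^ 2) * d ^ 2 ≤ (n + 1 + C / d ^ 2) * ‖w - (y + a n • ν)‖ ^ 2 := by
      gcongr
    nlinarith [show (0:ℝ) < (n + 1) * d ^ 2 by positivity]
  choose A hAn hAΩ using hpen
  have hA0 (n : ℕ) : 0 < A n := by linarith [hAn n, (n.cast_nonneg : (0:ℝ) ≤ n)]
  set pen : ℕ → (Euc N × ℝ) × (Euc N × ℝ) → ℝ := fun n q =>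
    A n * ‖q.1.1 - (q.2.1 + a n • ν)‖ ^ 2 + ‖q.1.1 - z‖ ^ 2 + Λ * (q.1.2 - q.2.2) ^ 2 + χ q.1.2
    with hpendef
  have hpenc (n : ℕ) : Continuous (pen n) := by
    have := hχ.continuous
    fun_prop
  have hex (n : ℕ) := exists_max_sub_sub hu hv hKc hKne hKS (hpenc n).continuousOn
  choose q hqK hqmax using hex
  set x : ℕ → Euc N := fun n => (q n).1.1 with hx
  set t : ℕ → ℝ := fun n => (q n).1.2 with ht
  set y : ℕ → Euc N := fun n => (q n).2.1 with hy
  set s : ℕ → ℝ := fun n => (q n).2.2 with hs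
  have hxΩ (n : ℕ) : x n ∈ closure Ω := (hqK n).1.1
  have htI (n : ℕ) : t n ∈ Icc 0 T₁ := (hqK n).1.2
  have hyΩ (n : ℕ) : y n ∈ closure Ω := (hqK n).2.1
  have hsI (n : ℕ) : s n ∈ Icc 0 T₂ := (hqK n).2.2
  set w : ℕ → ℝ := fun n => u (z + a n • ν, τ) - v (z, σ) - a n ^ 2 * ‖ν‖ ^ 2
    - Λ * (τ - σ) ^ 2 - χ τ with hw
  have hzΩ (n : ℕ) : z + a n • ν ∈ closure Ω :=
    subset_closure (hshift z hz (by rw [dist_self]; exact hr.le) _ (ha0 n) (har n))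
  have hlow (n : ℕ) : w n ≤ u (x n, t n) - v (y n, s n) - (A n * ‖x n - (y n + a n • ν)‖ ^ 2
      + ‖x n - z‖ ^ 2 + Λ * (t n - s n) ^ 2 + χ (t n)) := by
    have := hqmax n ((z + a n • ν, τ), (z, σ)) ⟨⟨hzΩ n, hτ⟩, hz, hσ⟩
    simp only [hpendef, sub_self, norm_zero, add_sub_cancel_left, norm_smul,
      Real.norm_of_nonneg (ha0 n).le, mul_pow] at this
    simp only [hw]
    linarith
  have hwlim : Tendsto w (hyperfilter ℕ : Filter ℕ) (𝓝 M) := by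
    have h1 : Tendsto (fun n => (z + a n • ν, τ)) (hyperfilter ℕ : Filter ℕ)
        (𝓝[closure Ω ×ˢ Ici (0:ℝ)] (z, τ)) := by
      refine tendsto_nhdsWithin_iff.2 ⟨?_, Eventually.of_forall fun n => ⟨hzΩ n, hτ.1⟩⟩
      have : Tendsto (fun n => z + a n • ν) (hyperfilter ℕ : Filter ℕ) (𝓝 (z + (0:ℝ) • ν)) :=
        tendsto_const_nhds.add (hatop.smul_const ν)
      rw [zero_smul, add_zero] at this
      exact this.prodMk_nhds tendsto_const_nhds
    have h2 := (hu (z, τ) ⟨hz, hτ.1⟩).tendsto.comp h1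
    have h3 := (((h2.sub_const (v (z, σ))).sub ((hatop.pow 2).mul_const (‖ν‖ ^ 2))).sub_const
      (Λ * (τ - σ) ^ 2)).sub_const (χ τ)
    rw [hval]
    simpa using h3
  have hpen_le : ∀ᶠ n in (hyperfilter ℕ : Filter ℕ), A n * ‖x n - (y n + a n • ν)‖ ^ 2 ≤ C := by
    filter_upwards [hwlim.eventually_const_lt hM] with n hn
    have h1 := hlow n
    have h2 := hC _ (hqK n)
    have h3 : 0 ≤ Λ * (t n - s n) ^ 2 := by positivity
    have h4 : u (x n, t n) - v (y n, s n) ≤ C := h2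
    linarith [hχ_nonneg (t n), sq_nonneg ‖x n - z‖]
  obtain ⟨x', hx'Ω, hxlim⟩ := hK.exists_tendsto_hyperfilter (Eventually.of_forall hxΩ)
  obtain ⟨t', ht'I, htlim⟩ := isCompact_Icc.exists_tendsto_hyperfilter (Eventually.of_forall htI)
  obtain ⟨s', hs'I, hslim⟩ := isCompact_Icc.exists_tendsto_hyperfilter (Eventually.of_forall hsI)
  have hdiff : Tendsto (fun n => x n - (y n + a n • ν)) (hyperfilter ℕ : Filter ℕ) (𝓝 0) := by
    have h1 : Tendsto (fun n : ℕ => √(C / (n + 1))) (hyperfilter ℕ : Filter ℕ) (𝓝 0) := by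
      have := (tendsto_const_nhds (x := C)).div_atTop
        (tendsto_atTop_add_const_right atTop (1:ℝ) tendsto_natCast_atTop_atTop)
      have := (this.mono_left Nat.hyperfilter_le_atTop).sqrt
      rwa [Real.sqrt_zero] at this
    refine squeeze_zero_norm' ?_ h1
    filter_upwards [hpen_le] with n hn
    refine Real.le_sqrt_of_sq_le ?_
    rw [le_div_iff₀ (by positivity), mul_comm]
    exact (mul_le_mul_of_nonneg_right (hAn n) (sq_nonneg _)).trans hn
  have hylim : Tendsto y (hyperfilter ℕ : Filter ℕ) (𝓝 x') := by
    have := (hxlim.sub hdiff).sub (hatop.smul_const ν)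
    simp only [zero_smul, sub_zero] at this
    refine this.congr fun n => ?_
    abel
  have hulim : Tendsto (fun n => u (x n, t n)) (hyperfilter ℕ : Filter ℕ) (𝓝 (u (x', t'))) :=
    (hu (x', t') ⟨hx'Ω, ht'I.1⟩).tendsto.comp (tendsto_nhdsWithin_iff.2
      ⟨hxlim.prodMk_nhds htlim, Eventually.of_forall fun n => ⟨hxΩ n, (htI n).1⟩⟩)
  have hvle : v (x', s') ≤ u (x', t') - (‖x' - z‖ ^ 2 + Λ * (t' - s') ^ 2 + χ t') - M := by
    refine hv.le_of_tendsto (l := (hyperfilter ℕ : Filter ℕ)) (hylim.prodMk_nhds hslim)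
      (fun n => ⟨hyΩ n, (hsI n).1⟩) ⟨hx'Ω, hs'I.1⟩
      ((hulim.sub ((((hxlim.sub_const z).norm.pow 2).add (((htlim.sub hslim).pow 2).const_mul
      Λ)).add ((hχ.continuous.tendsto t').comp htlim))).sub hwlim) (Eventually.of_forall fun n => ?_)
    have h1 := hlow n
    have h2 : 0 ≤ A n * ‖x n - (y n + a n • ν)‖ ^ 2 := mul_nonneg (hA0 n).le (sq_nonneg _)
    simp only [Function.comp_apply]
    linarith
  have hx'z : x' = z := by
    have h1 := hmax x' hx'Ω t' ht'I s' hs'I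
    have h2 : ‖x' - z‖ ^ 2 ≤ 0 := by linarith
    have h3 : ‖x' - z‖ = 0 := pow_eq_zero_iff two_ne_zero |>.1 (le_antisymm h2 (sq_nonneg _))
    exact sub_eq_zero.1 (norm_eq_zero.1 h3)
  subst hx'z
  rw [sub_self, norm_zero] at hvle
  obtain ⟨ht', hs'⟩ := hinterior t' ht'I s' hs'I (by linarith)
  have hgap : ∀ᶠ n in (hyperfilter ℕ : Filter ℕ), v (y n, s n) < u (y n, t n) := by
    have huy : Tendsto (fun n => u (y n, t n)) (hyperfilter ℕ : Filter ℕ) (𝓝 (u (x', t'))) :=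
      (hu (x', t') ⟨hx'Ω, ht'I.1⟩).tendsto.comp (tendsto_nhdsWithin_iff.2
        ⟨hylim.prodMk_nhds htlim, Eventually.of_forall fun n => ⟨hyΩ n, (htI n).1⟩⟩)
    have h1 := (huy.sub hulim).add hwlim
    rw [sub_self, zero_add] at h1
    filter_upwards [h1.eventually_const_lt hM] with n hn
    have h2 := hlow n
    have h3 : 0 ≤ A n * ‖x n - (y n + a n • ν)‖ ^ 2 := mul_nonneg (hA0 n).le (sq_nonneg _)
    have h4 : 0 ≤ Λ * (t n - s n) ^ 2 := by positivity
    linarith [hχ_nonneg (t n), sq_nonneg ‖x n - x'‖]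
  set p : ℕ → Euc N := fun n => (2 * A n) • (x n - (y n + a n • ν)) with hp
  have hsub_ineq : ∀ᶠ n in (hyperfilter ℕ : Filter ℕ),
      2 * Λ * (t n - s n) + deriv χ (t n) + H (x n) (p n + (2:ℝ) • (x n - x')) ≤ 0 := by
    have hball : ∀ᶠ n in (hyperfilter ℕ : Filter ℕ), dist (y n) x' ≤ r :=
      hylim.eventually (closedBall_mem_nhds x' hr)
    filter_upwards [hpen_le, hball, htlim.eventually (Ioo_mem_nhds ht'.1 ht'.2)]
      with n hn hyn htn
    have hxn : x n ∈ Ω := hAΩ n (y n) (hyΩ n) hyn _ hn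
    have hder : HasDerivAt (fun b : ℝ => Λ * (b - s n) ^ 2 + χ b)
        (2 * Λ * (t n - s n) + deriv χ (t n)) (t n) := by
      refine (((((hasDerivAt_id' (t n)).sub_const (s n)).fun_pow 2).const_mul Λ).add
        (hχ.differentiable one_ne_zero (t n)).hasDerivAt).congr_deriv ?_
      push_cast
      ring
    have hgrad := hasGradientAt_norm_sub_sq_add (A n) 1 (y n + a n • ν) x' (x n)
    have := hsub _ (((contDiff_norm_sub_sq_add (A n) 1 (y n + a n • ν) x').comp contDiff_fst).add
      (((contDiff_const (c := Λ)).mul ((contDiff_snd.sub (contDiff_const (c := s n))).pow 2)).add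
      (hχ.comp contDiff_snd))) (x n) hxn (t n) htn.1 ?_
    · erw [timeDeriv_add_separated hgrad hder, spaceGrad_add_separated hgrad
        (fun b : ℝ => Λ * (b - s n) ^ 2 + χ b)] at this
      simpa using this
    · have hnhds : ∀ᶠ o : Euc N × ℝ in 𝓝 (x n, t n), o.2 ∈ Icc 0 T₁ :=
        continuous_snd.continuousAt.eventually (Icc_mem_nhds htn.1 htn.2)
      filter_upwards [mem_nhdsWithin_of_mem_nhds hnhds, self_mem_nhdsWithin] with o ho hoS
      have := hqmax n (o, (y n, s n)) ⟨⟨subset_closure hoS.1, ho⟩, hyΩ n, hsI n⟩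
      simp only [hpendef] at this
      change u o - _ ≤ u (q n).1 - _
      simp only [Function.comp_apply, one_mul, hx, hy, ht, hs] at this ⊢
      linarith
  have hsuper_ineq : ∀ᶠ n in (hyperfilter ℕ : Filter ℕ),
      0 ≤ 2 * Λ * (t n - s n) + H (y n) (p n) := by
    filter_upwards [hgap, htlim.eventually (Ioo_mem_nhds ht'.1 ht'.2),
      hslim.eventually (Ioo_mem_nhds hs'.1 hs'.2)] with n hn htn hsn
    have hder : HasDerivAt (fun b : ℝ => -Λ * (b - t n) ^ 2) (2 * Λ * (t n - s n)) (s n) := by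
      refine ((((hasDerivAt_id' (s n)).sub_const (t n)).fun_pow 2).const_mul (-Λ)).congr_deriv ?_
      push_cast
      ring
    have hgrad := hasGradientAt_norm_sub_sq_add (-A n) 0 (x n - a n • ν) x' (y n)
    have hpn : (2 * -A n) • (y n - (x n - a n • ν)) + (2 * (0:ℝ)) • (y n - x') = p n := by
      simp only [hp]
      module
    rw [hpn] at hgrad
    have := hsuper _ (((contDiff_norm_sub_sq_add (-A n) 0 (x n - a n • ν) x').comp
      contDiff_fst).add ((contDiff_const (c := -Λ)).mul
      ((contDiff_snd.sub (contDiff_const (c := t n))).pow 2))) (y n) (hyΩ n) (s n) hsn.1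
      ⟨t n, htn.1, hn⟩ ?_
    · erw [timeDeriv_add_separated hgrad hder, spaceGrad_add_separated hgrad
        (fun b : ℝ => -Λ * (b - t n) ^ 2)] at this
      exact this
    · have hnhds : ∀ᶠ o : Euc N × ℝ in 𝓝 (y n, s n), o.2 ∈ Icc 0 T₂ :=
        continuous_snd.continuousAt.eventually (Icc_mem_nhds hsn.1 hsn.2)
      filter_upwards [mem_nhdsWithin_of_mem_nhds hnhds, self_mem_nhdsWithin] with o ho hoS
      have := hqmax n ((x n, t n), o) ⟨⟨hxΩ n, htI n⟩, hoS.1, ho⟩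
      have hnorm (b : Euc N) : ‖b - (x n - a n • ν)‖ = ‖x n - (b + a n • ν)‖ := by
        rw [← norm_neg]; congr 1; abel
      have hsq (b : ℝ) : (b - t n) ^ 2 = (t n - b) ^ 2 := by ring
      simp only [hpendef] at this
      change v (q n).2 - _ ≤ v o - _
      simp only [Function.comp_apply, hnorm, hsq]
      simp only [hx, hy, ht, hs] at this ⊢
      linarith
  obtain ⟨R, hR⟩ := hcoer (2 * Λ * T₂ + 1)
  have hbdd : ∀ᶠ n in (hyperfilter ℕ : Filter ℕ),
      p n + (2:ℝ) • (x n - x') ∈ closedBall (0 : Euc N) R := by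
    filter_upwards [hsub_ineq] with n hn
    rw [mem_closedBall_zero_iff]
    by_contra! hlt
    have h1 := hR (x n) (hxΩ n) _ hlt.le
    have h2 : Λ * s n ≤ Λ * T₂ := by gcongr; exact (hsI n).2
    have h3 : 0 ≤ Λ * t n := mul_nonneg hΛ (htI n).1
    linarith [hχ_deriv (t n)]
  obtain ⟨P, -, hPlim⟩ := (isCompact_closedBall (0 : Euc N) R).exists_tendsto_hyperfilter hbdd
  have hplim : Tendsto p (hyperfilter ℕ : Filter ℕ) (𝓝 P) := by
    have := hPlim.sub ((hxlim.sub_const x').const_smul (2:ℝ))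
    simpa using this
  have hHlim {b c : ℕ → Euc N} (hb : ∀ n, b n ∈ closure Ω)
      (hb' : Tendsto b (hyperfilter ℕ : Filter ℕ) (𝓝 x'))
      (hc : Tendsto c (hyperfilter ℕ : Filter ℕ) (𝓝 P)) :
      Tendsto (fun n => H (b n) (c n)) (hyperfilter ℕ : Filter ℕ) (𝓝 (H x' P)) :=
    (hH (x', P) ⟨hx'Ω, mem_univ _⟩).tendsto.comp (tendsto_nhdsWithin_iff.2
      ⟨hb'.prodMk_nhds hc, Eventually.of_forall fun n => ⟨hb n, mem_univ _⟩⟩)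
  have htime := (htlim.sub hslim).const_mul (2 * Λ)
  have h1 := le_of_tendsto ((htime.add (((hχ.continuous_deriv le_rfl).tendsto t').comp htlim)).add
    (hHlim hxΩ hxlim hPlim)) hsub_ineq
  have h2 := ge_of_tendsto (htime.add (hHlim hyΩ hylim hplim)) hsuper_ineq
  linarith [hχ_deriv t']

/-- A strong enough penalty on `|t - s|` keeps both times away from the initial time. -/
lemma exists_time_penalty {X : Type*} [TopologicalSpace X] {S : Set X} (hS : IsCompact S)
    {u v : X × ℝ → ℝ} (hu : ContinuousOn u (S ×ˢ Ici (0:ℝ)))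
    (hv : LowerSemicontinuousOn v (S ×ˢ Ici (0:ℝ))) (hinit : ∀ x ∈ S, u (x, 0) ≤ v (x, 0))
    {T₁ T₂ C m : ℝ} (hm : 0 < m)
    (hC : ∀ x ∈ S, ∀ t ∈ Icc 0 T₁, ∀ s ∈ Icc 0 T₂, u (x, t) - v (x, s) ≤ C) :
    ∃ Λ : ℝ, C ≤ Λ ∧ 0 ≤ Λ ∧ ∀ x ∈ S, ∀ t ∈ Icc 0 T₁, ∀ s ∈ Icc 0 T₂, t * s = 0 →
      u (x, t) - v (x, s) - Λ * (t - s) ^ 2 < m := by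
  by_contra! hcon
  have hΛ (n : ℕ) := hcon (|C| + (n + 1)) (by linarith [le_abs_self C,
    (n.cast_nonneg : (0:ℝ) ≤ n)]) (by positivity)
  choose x hx t ht s hs hts hle using hΛ
  obtain ⟨x', hx', hxlim⟩ := hS.exists_tendsto_hyperfilter (Eventually.of_forall hx)
  obtain ⟨t', ht', htlim⟩ := isCompact_Icc.exists_tendsto_hyperfilter (Eventually.of_forall ht)
  obtain ⟨s', hs', hslim⟩ := isCompact_Icc.exists_tendsto_hyperfilter (Eventually.of_forall hs)
  have hmul : t' * s' = 0 := by
    refine tendsto_nhds_unique (htlim.mul hslim) ?_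
    simp only [hts, tendsto_const_nhds]
  have hsq : (t' - s') ^ 2 ≤ 0 := by
    have h1 := ((tendsto_const_nhds (x := C)).div_atTop
      (tendsto_atTop_add_const_right atTop (1:ℝ) tendsto_natCast_atTop_atTop)).mono_left
      Nat.hyperfilter_le_atTop
    refine le_of_tendsto_of_tendsto ((htlim.sub hslim).pow 2) h1 (Eventually.of_forall fun n => ?_)
    rw [le_div_iff₀ (by positivity)]
    have h2 := hle n
    have h3 := hC _ (hx n) _ (ht n) _ (hs n)
    have h4 : 0 ≤ |C| * (t n - s n) ^ 2 := by positivity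
    linarith
  have heq : t' = s' := sub_eq_zero.1 (pow_eq_zero_iff two_ne_zero |>.1
    (le_antisymm hsq (sq_nonneg _)))
  obtain rfl : s' = 0 := by rw [heq] at hmul; exact mul_self_eq_zero.1 hmul
  subst heq
  have hulim : Tendsto (fun n => u (x n, t n)) (hyperfilter ℕ : Filter ℕ) (𝓝 (u (x', 0))) :=
    (hu (x', 0) ⟨hx', self_mem_Ici⟩).tendsto.comp (tendsto_nhdsWithin_iff.2
      ⟨hxlim.prodMk_nhds htlim, Eventually.of_forall fun n => ⟨hx n, (ht n).1⟩⟩)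
  have hvle : v (x', 0) ≤ u (x', 0) - m := by
    refine hv.le_of_tendsto (l := (hyperfilter ℕ : Filter ℕ)) (hxlim.prodMk_nhds hslim)
      (fun n => ⟨hx n, (hs n).1⟩) ⟨hx', self_mem_Ici⟩ (hulim.sub_const m)
      (Eventually.of_forall fun n => ?_)
    have h1 := hle n
    have h2 : 0 ≤ (|C| + (n + 1)) * (t n - s n) ^ 2 := by positivity
    linarith
  linarith [hinit x' hx']

/-- Comparison principle when `v` is a supersolution at the points `(x, s)` of
`closure Ω × (0,∞)` at which it lies below some value `u (x, t)`, `t > 0`. -/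
lemma le_of_parSubOn_of_super {N : ℕ} {Ω : Set (Euc N)} {H : Euc N → Euc N → ℝ}
    {u v : Euc N × ℝ → ℝ} (hΩ : IsOpen Ω) (hK : IsCompact (closure Ω)) (hC0 : HasC0Boundary Ω)
    (hH : ContinuousOn (fun q : Euc N × Euc N => H q.1 q.2) (closure Ω ×ˢ (univ : Set (Euc N))))
    (hcoer : Coercive Ω H) (hu : ContinuousOn u (closure Ω ×ˢ Ici (0:ℝ)))
    (hv : LowerSemicontinuousOn v (closure Ω ×ˢ Ici (0:ℝ))) (hsub : ParSubOn H u Ω)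
    (hsuper : ∀ φ : Euc N × ℝ → ℝ, ContDiff ℝ 1 φ → ∀ x ∈ closure Ω, ∀ s : ℝ, 0 < s →
      (∃ t : ℝ, 0 < t ∧ v (x, s) < u (x, t)) →
      IsLocalMinOn (fun p => v p - φ p) (closure Ω ×ˢ Ioi (0:ℝ)) (x, s) →
      0 ≤ timeDeriv φ (x, s) + H x (spaceGrad φ (x, s)))
    (hinit : ∀ x ∈ closure Ω, u (x, 0) ≤ v (x, 0)) {x₀ : Euc N} (hx₀ : x₀ ∈ closure Ω) {t₀ : ℝ}
    (ht₀ : 0 ≤ t₀) : u (x₀, t₀) ≤ v (x₀, t₀) := by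
  by_contra! hlt
  obtain ⟨β, hβ, hβlt⟩ : ∃ β, 0 < β ∧ 2 * β = u (x₀, t₀) - v (x₀, t₀) :=
    ⟨(u (x₀, t₀) - v (x₀, t₀)) / 2, by linarith, by ring⟩
  set K : Set ((Euc N × ℝ) × (Euc N × ℝ)) :=
    ((closure Ω ×ˢ Icc 0 (t₀ + 1)) ×ˢ (closure Ω ×ˢ Icc 0 (t₀ + 2))) ∩ {q | q.1.1 = q.2.1}
  have hKc : IsCompact K := ((hK.prod isCompact_Icc).prod (hK.prod isCompact_Icc)).inter_right
    (isClosed_eq (by fun_prop) (by fun_prop))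
  have hKS : K ⊆ (closure Ω ×ˢ Ici (0:ℝ)) ×ˢ (closure Ω ×ˢ Ici (0:ℝ)) :=
    inter_subset_left.trans (prod_mono (prod_mono_right Icc_subset_Ici_self)
      (prod_mono_right Icc_subset_Ici_self))
  have hmemK {x : Euc N} (hx : x ∈ closure Ω) {t s : ℝ} (ht : t ∈ Icc 0 (t₀ + 1))
      (hs : s ∈ Icc 0 (t₀ + 2)) : ((x, t), (x, s)) ∈ K := ⟨⟨⟨hx, ht⟩, hx, hs⟩, rfl⟩
  have ht₁ : t₀ ∈ Icc 0 (t₀ + 1) := ⟨ht₀, by linarith⟩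
  have ht₂ : t₀ ∈ Icc 0 (t₀ + 2) := ⟨ht₀, by linarith⟩
  have hKne : K.Nonempty := ⟨_, hmemK hx₀ ht₁ ht₂⟩
  obtain ⟨C, hC⟩ : ∃ C : ℝ, ∀ x ∈ closure Ω, ∀ t ∈ Icc 0 (t₀ + 1), ∀ s ∈ Icc 0 (t₀ + 2),
      u (x, t) - v (x, s) ≤ C := by
    obtain ⟨q, -, hq⟩ := exists_max_sub_sub hu hv hKc hKne hKS
      (c := fun _ => 0) continuousOn_const
    refine ⟨u q.1 - v q.2, fun x hx t ht s hs => ?_⟩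
    have := hq _ (hmemK hx ht hs)
    simpa using this
  obtain ⟨Λ, hCΛ, hΛ, hpen⟩ := exists_time_penalty hK hu hv hinit hβ hC
  have hC0' : 0 < C := by linarith [hC x₀ hx₀ t₀ ht₁ t₀ ht₂]
  obtain ⟨k, hk, hkC⟩ : ∃ k : ℝ, 0 < k ∧ C ≤ β * Real.exp k := by
    refine ⟨C / β, by positivity, ?_⟩
    have h1 := Real.add_one_le_exp (C / β)
    calc C = β * (C / β) := by field_simp
      _ ≤ β * Real.exp (C / β) := by gcongr; linarith
  set χ : ℝ → ℝ := fun t => β * Real.exp (k * (t - t₀)) with hχ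
  have hχpos (t : ℝ) : 0 < χ t := by positivity
  have hχder (t : ℝ) : 0 < deriv χ t := by
    have : HasDerivAt χ (β * (Real.exp (k * (t - t₀)) * (k * 1))) t :=
      ((((hasDerivAt_id' t).sub_const t₀).const_mul k).exp).const_mul β
    rw [this.deriv]
    positivity
  have hχC : ContDiff ℝ 1 χ := by fun_prop
  obtain ⟨⟨⟨z, τ⟩, ⟨z', σ⟩⟩, ⟨⟨⟨hz, hτ⟩, -, hσ⟩, hzz'⟩, hqmax⟩ :=
    exists_max_sub_sub hu hv hKc hKne hKS
    (c := fun q => Λ * (q.1.2 - q.2.2) ^ 2 + χ q.1.2)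
    (by have := hχC.continuous; fun_prop)
  obtain rfl : z = z' := hzz'
  obtain ⟨ν, r, hr, hshift⟩ := hC0.exists_inward_shift hΩ hz
  have hmax : ∀ x ∈ closure Ω, ∀ t ∈ Icc 0 (t₀ + 1), ∀ s ∈ Icc 0 (t₀ + 2),
      u (x, t) - v (x, s) - Λ * (t - s) ^ 2 - χ t
        ≤ u (z, τ) - v (z, σ) - Λ * (τ - σ) ^ 2 - χ τ := by
    intro x hx t ht s hs
    have := hqmax _ (hmemK hx ht hs)
    simp only at this
    linarith
  have hM : β ≤ u (z, τ) - v (z, σ) - Λ * (τ - σ) ^ 2 - χ τ := by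
    have h1 := hmax x₀ hx₀ t₀ ht₁ t₀ ht₂
    have h2 : χ t₀ = β := by simp [hχ]
    rw [h2, sub_self] at h1
    linarith
  refine false_of_doubling hΩ hK hH hcoer hu hv hsub hsuper hΛ (hβ.trans_le hM) hχC
    (fun t => (hχpos t).le) hχder hz hr hshift hτ hσ rfl hmax ?_
  intro t ht s hs hle
  have hCts := hC z hz t ht s hs
  have hχt := hχpos t
  have hsq : 0 ≤ Λ * (t - s) ^ 2 := by positivity
  have hts : t * s ≠ 0 := fun h0 => by linarith [hpen z hz t ht s hs h0]
  refine ⟨⟨ht.1.lt_of_ne fun h => hts (by rw [← h, zero_mul]), ht.2.lt_of_ne fun h => ?_⟩,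
    ⟨hs.1.lt_of_ne fun h => hts (by rw [← h, mul_zero]), hs.2.lt_of_ne fun h => ?_⟩⟩
  · have : χ t = β * Real.exp k := by simp [hχ, h]
    linarith
  · have h1 : 1 ≤ (t - s) ^ 2 := by
      rw [h]; nlinarith [ht.2]
    nlinarith

/-- comparison principle for the state-constraint problem (SC)
and for the Cauchy–Dirichlet problem (CD). -/
theorem statement19
    (N : ℕ) (Ω : Set (Euc N)) (H : Euc N → Euc N → ℝ) (g : Euc N → ℝ)
    (hΩopen : IsOpen Ω) (hΩconn : IsConnected Ω) (hΩbdd : Bornology.IsBounded Ω)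
    (hΩC0 : HasC0Boundary Ω)
    (hHcont : ContinuousOn (fun q : Euc N × Euc N => H q.1 q.2)
      (closure Ω ×ˢ (univ : Set (Euc N))))
    (hcoer : Coercive Ω H)
    (u v : Euc N × ℝ → ℝ)
    (hucont : ContinuousOn u (closure Ω ×ˢ Ici (0:ℝ)))
    (hcase : (IsSCSub Ω H u ∧ IsSCSuper Ω H v) ∨
      (ContinuousOn g (frontier Ω) ∧ IsCDSub Ω H g u ∧ IsCDSuper Ω H g v))
    (hinit : ∀ x ∈ closure Ω, u (x, 0) ≤ v (x, 0)) :
    ∀ x ∈ closure Ω, ∀ t : ℝ, 0 ≤ t → u (x, t) ≤ v (x, t) := by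
  have hK : IsCompact (closure Ω) := hΩbdd.isCompact_closure
  intro x hx t ht
  rcases hcase with ⟨hsub, hsuper⟩ | ⟨hg, hsub, hsuper⟩
  · exact le_of_parSubOn_of_super hΩopen hK hΩC0 hHcont hcoer hucont hsuper.1 hsub.2
      (fun φ hφ y hy s hs _ hmin => hsuper.2 φ hφ y hy s hs hmin) hinit hx ht
  · refine le_of_parSubOn_of_super hΩopen hK hΩC0 hHcont hcoer hucont hsuper.1 hsub.2.1
      (fun φ hφ y hy s hs hlt hmin => ?_) hinit hx ht
    by_cases hyΩ : y ∈ Ω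
    · exact hsuper.2.1 φ hφ y hyΩ s hs (hmin.on_subset (prod_mono_left subset_closure))
    · have hyf : y ∈ frontier Ω := by
        rw [hΩopen.frontier_eq]
        exact ⟨hy, hyΩ⟩
      obtain ⟨t', ht', hlt⟩ := hlt
      have hug := hsub.le_boundary_datum hΩopen hK hΩC0 hcoer hucont hg hyf ht'
      exact (le_max_iff.1 (hsuper.2.2 φ hφ y hyf s hs hmin)).resolve_right (by linarith)
end
end
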